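/- arXiv:1809.05631 — 2 statements merged into one kernel-verified Lean document; each statement's English description precedes it below -/
import Mathlib

section
/- Assume I_{ε,r} > −1. Let X be the number of good vertices of 𝔾(n,p₂,p₃). Then there exists a constant κ > 0 such that E[X] > n^κ for all sufficiently large n. -/
open MeasureTheory Real Filter ENNReal

/-- Bernoulli-type measure on `Bool` with success probability `p`. -/
noncomputable def bern (p : ℝ) : Measure Bool :=
  (ENNReal.ofReal p) • Measure.dirac true + (ENNReal.ofReal (1 - p)) • Measure.dirac false

instance bern_finite (p : ℝ) : IsFiniteMeasure (bern p) := by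
  constructor
  simp only [bern, Measure.coe_add, Measure.coe_smul, Pi.add_apply, Pi.smul_apply,
    smul_eq_mul]
  finiteness

/-- Index type of potential edges: subsets of size 2 or 3. -/
abbrev EdgeIdx (n : ℕ) := {e : Finset (Fin n) // e.card = 2 ∨ e.card = 3}

/-- The law of the random hypergraph `𝔾(n, p₂, p₃)` with `p₂ = (1-ε)/n` and
`p₃ = r/(n ln n)`: the product of Bernoulli measures over all 2- and 3-subsets. -/
noncomputable def hypMeasure (n : ℕ) (ε r : ℝ) : Measure (EdgeIdx n → Bool) :=
  Measure.pi fun e =>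
    bern (if e.1.card = 2 then (1 - ε) / n else r / (n * Real.log n))

/-- `e` is an edge of the configuration `ω`. -/
def IsEdge {n : ℕ} (ω : EdgeIdx n → Bool) (e : Finset (Fin n)) : Prop :=
  ∃ h : e.card = 2 ∨ e.card = 3, ω ⟨e, h⟩ = true

/-- The constant `I_{ε,r} = -(1/r)(ε - ε²/2 + (1-ε)ln(1-ε))`. -/
noncomputable def Ier (ε r : ℝ) : ℝ :=
  -(1 / r) * (ε - ε ^ 2 / 2 + (1 - ε) * Real.log (1 - ε))

/-- The constant `K₀ = max {1, 2(9+ε)/r}`. -/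
noncomputable def K0 (ε r : ℝ) : ℝ := max 1 (2 * (9 + ε) / r)

/-- `f 0, …, f (k-1)` is a propagation sequence from the vertex set `S`:
every `f l` is an edge and meets `S ∪ f 0 ∪ ⋯ ∪ f (l-1)` in all but exactly
one vertex. -/
def IsPropSeqFrom {n : ℕ} (ω : EdgeIdx n → Bool) (S : Finset (Fin n))
    (k : ℕ) (f : ℕ → Finset (Fin n)) : Prop :=
  (∀ i < k, IsEdge ω (f i)) ∧
  ∀ l < k, (f l ∩ (S ∪ (Finset.range l).biUnion f)).card = (f l).card - 1

/-- The propagation component of the vertex set `S`: the union of `S` with all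
edges occurring in propagation sequences from `S`. -/
def propComponent {n : ℕ} (ω : EdgeIdx n → Bool) (S : Finset (Fin n)) : Set (Fin n) :=
  ↑S ∪ {x | ∃ k f, IsPropSeqFrom ω S k f ∧ ∃ i < k, x ∈ f i}

/-- The number of good vertices: vertices whose propagation component has at
least `K₀ ln n` vertices. -/
noncomputable def goodCount (n : ℕ) (ε r : ℝ) (ω : EdgeIdx n → Bool) : ℕ :=
  Set.ncard {v : Fin n | K0 ε r * Real.log n ≤ ((propComponent ω {v}).ncard : ℝ)}

section ProductMeasure

variable {ι : Type*} [Fintype ι]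

/-- Events of a finite product of probability measures on `Bool` which depend on disjoint sets of
coordinates are independent. -/
lemma measureReal_pi_inter_of_dependsOn (m : ι → Measure Bool) [∀ i, IsProbabilityMeasure (m i)]
    {A B : Set (ι → Bool)} {E F : Finset ι} (hEF : Disjoint E F)
    (hA : DependsOn (fun ω => ω ∈ A) (E : Set ι)) (hB : DependsOn (fun ω => ω ∈ B) (F : Set ι)) :
    (Measure.pi m).real (A ∩ B) = (Measure.pi m).real A * (Measure.pi m).real B := by
  have hind : ProbabilityTheory.iIndepFun (fun i (ω : ι → Bool) => ω i) (Measure.pi m) :=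
    ProbabilityTheory.iIndepFun_pi (X := fun _ => id) fun _ => aemeasurable_id
  have h := hind.indepFun_finset E F hEF (fun i => measurable_pi_apply i)
  have key : ∀ {C : Set (ι → Bool)} {G : Finset ι}, DependsOn (fun ω => ω ∈ C) (G : Set ι) →
      C = (fun (ω : ι → Bool) (i : G) => ω i) ⁻¹' ((fun (ω : ι → Bool) (i : G) => ω i) '' C) := by
    intro C G hC
    refine Set.Subset.antisymm (Set.subset_preimage_image _ _) ?_
    rintro ω ⟨ω', hω', heq⟩
    have : (ω' ∈ C) = (ω ∈ C) := hC fun i hi => congrFun heq ⟨i, hi⟩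
    exact this ▸ hω'
  rw [key hA, key hB, measureReal_def, h.measure_inter_preimage_eq_mul _ _
    (Set.toFinite _).measurableSet (Set.toFinite _).measurableSet, ENNReal.toReal_mul]
  rfl

/-- Product formula for finitely many events depending on pairwise disjoint sets of coordinates. -/
lemma measureReal_pi_biInter_of_dependsOn {κ : Type*} [DecidableEq κ] [DecidableEq ι]
    (m : ι → Measure Bool)
    [∀ i, IsProbabilityMeasure (m i)] (W : Finset κ) (A : κ → Set (ι → Bool))
    (E : κ → Finset ι) (hE : (W : Set κ).PairwiseDisjoint E)
    (hA : ∀ w ∈ W, DependsOn (fun ω => ω ∈ A w) (E w : Set ι)) :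
    (Measure.pi m).real (⋂ w ∈ W, A w) = ∏ w ∈ W, (Measure.pi m).real (A w) := by
  induction W using Finset.induction_on with
  | empty => simp
  | insert a s ha ih =>
    have hd : Disjoint (E a) (s.biUnion E) := by
      rw [Finset.disjoint_biUnion_right]
      intro i hi
      exact hE (by simp) (by simp [hi]) (fun h => ha (h ▸ hi))
    rw [Finset.prod_insert ha, Finset.set_biInter_insert,
      measureReal_pi_inter_of_dependsOn m hd (hA a (by simp)), ih]
    · exact hE.subset (by simp)
    · exact fun w hw => hA w (by simp [hw])
    · intro x y hxy
      simp only [Set.mem_iInter, eq_iff_iff]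
      refine forall₂_congr fun w hw => ?_
      have := hA w (by simp [hw]) (x := x) (y := y) fun i hi =>
        hxy i (by simpa using ⟨w, hw, hi⟩)
      exact iff_of_eq this

/-- The probability that all coordinates in `E` vanish. -/
lemma measureReal_pi_forall_eq_false [DecidableEq ι] (m : ι → Measure Bool)
    [∀ i, IsProbabilityMeasure (m i)] (E : Finset ι) :
    (Measure.pi m).real {ω | ∀ e ∈ E, ω e = false} = ∏ e ∈ E, (m e).real {false} := by
  have h := measureReal_pi_biInter_of_dependsOn m E (fun e => {ω | ω e = false}) (fun e => {e})
    (fun a _ b _ hab => by simpa [Function.onFun] using hab) (fun w _ x y hxy => by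
      have : x w = y w := hxy w (by simp)
      simp [this])
  have h2 : {ω : ι → Bool | ∀ e ∈ E, ω e = false} = ⋂ e ∈ E, {ω | ω e = false} := by
    ext; simp
  rw [h2, h]
  refine Finset.prod_congr rfl fun e _ => ?_
  have h3 : {ω : ι → Bool | ω e = false} = Function.eval e ⁻¹' ({false} : Set Bool) := rfl
  rw [h3, (measurePreserving_eval m e).measureReal_preimage (by measurability)]

end ProductMeasure

lemma isProbabilityMeasure_bern {p : ℝ} (h0 : 0 ≤ p) (h1 : p ≤ 1) :
    IsProbabilityMeasure (bern p) := by
  constructor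
  simp only [bern, Measure.coe_add, Measure.coe_smul, Pi.add_apply, Pi.smul_apply, smul_eq_mul,
    measure_univ, mul_one]
  rw [← ENNReal.ofReal_add h0 (by linarith)]
  simp

lemma bern_real_false {p : ℝ} (h1 : p ≤ 1) : (bern p).real {false} = 1 - p := by
  simp [measureReal_def, bern, h1]

section Layers

variable {n : ℕ}

/-- The law of the random hypergraph with general edge probabilities. -/
noncomputable def edgeMeasure (n : ℕ) (p₂ p₃ : ℝ) : Measure (EdgeIdx n → Bool) :=
  Measure.pi fun e => bern (if e.1.card = 2 then p₂ else p₃)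

/-- Potential edges through `w` whose other vertices lie in `Q ∪ B`, not all of them in `Q`. -/
def links (Q B : Finset (Fin n)) (w : Fin n) : Finset (EdgeIdx n) :=
  Finset.univ.filter fun e => w ∈ e.1 ∧ e.1.erase w ⊆ Q ∪ B ∧ ¬ e.1.erase w ⊆ Q

lemma mem_links {Q B : Finset (Fin n)} {w : Fin n} {e : EdgeIdx n} :
    e ∈ links Q B w ↔ w ∈ e.1 ∧ e.1.erase w ⊆ Q ∪ B ∧ ¬ e.1.erase w ⊆ Q := by
  simp [links]

/-- The set of vertices outside `D` completing some edge of `links Q B` is `T`. -/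
def layerEvent (Q B D T : Finset (Fin n)) : Set (EdgeIdx n → Bool) :=
  ⋂ w ∈ Dᶜ, {ω | w ∈ T ↔ ∃ e ∈ links Q B w, ω e = true}

/-- Starting from the discovered set `D`, with active vertices `B` and helper vertices `Q`, `k`
further layers of exactly `b` vertices are discovered. The active vertices of each step become
helpers as long as there are fewer than `h` helpers. -/
def chainEvent (b h : ℕ) :
    ℕ → Finset (Fin n) → Finset (Fin n) → Finset (Fin n) → Set (EdgeIdx n → Bool)
  | 0, _, _, _ => Set.univ
  | k + 1, Q, B, D => ⋃ T ∈ Finset.powersetCard b Dᶜ,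
      layerEvent Q B D T ∩ chainEvent b h k (if Q.card < h then Q ∪ B else Q) T (D ∪ T)

lemma card_filter_links (Q B : Finset (Fin n)) (hQB : Disjoint Q B) (w : Fin n)
    (hw : w ∉ Q ∪ B) (j : ℕ) (hj : j = 1 ∨ j = 2) :
    ((links Q B w).filter fun e => e.1.card = j + 1).card =
      (Q.card + B.card).choose j - Q.card.choose j := by
  have h1 : ((links Q B w).filter fun e => e.1.card = j + 1).card =
      ((Q ∪ B).powersetCard j \ Q.powersetCard j).card := by
    refine Finset.card_bij' (fun e _ => e.1.erase w)
      (fun s hs => ⟨insert w s, ?_⟩) ?_ ?_ ?_ ?_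
    · simp only [Finset.mem_sdiff, Finset.mem_powersetCard] at hs
      rw [Finset.card_insert_of_notMem (fun h => hw (hs.1.1 h))]
      omega
    · intro e he
      simp only [Finset.mem_filter, mem_links] at he
      simp only [Finset.mem_sdiff, Finset.mem_powersetCard]
      have := Finset.card_erase_of_mem he.1.1
      refine ⟨⟨he.1.2.1, by omega⟩, fun h => he.1.2.2 h.1⟩
    · intro s hs
      simp only [Finset.mem_sdiff, Finset.mem_powersetCard] at hs
      have hws : w ∉ s := fun h => hw (hs.1.1 h)
      simp only [Finset.mem_filter, mem_links, Finset.erase_insert hws,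
        Finset.card_insert_of_notMem hws]
      refine ⟨⟨by simp, hs.1.1, fun h => hs.2 ⟨h, hs.1.2⟩⟩, by omega⟩
    · intro e he
      simp only [Finset.mem_filter, mem_links] at he
      exact Subtype.ext (Finset.insert_erase he.1.1)
    · intro s hs
      simp only [Finset.mem_sdiff, Finset.mem_powersetCard] at hs
      exact Finset.erase_insert fun h => hw (hs.1.1 h)
  rw [h1, Finset.card_sdiff_of_subset
    (Finset.powersetCard_mono Finset.subset_union_left), Finset.card_powersetCard,
    Finset.card_powersetCard, Finset.card_union_of_disjoint hQB]

/-- The probability that a fixed vertex is not reached from `a` active and `q` helper vertices. -/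
noncomputable def missProb (p₂ p₃ : ℝ) (q a : ℕ) : ℝ :=
  (1 - p₂) ^ a * (1 - p₃) ^ ((q + a).choose 2 - q.choose 2)

lemma isProbabilityMeasure_edge {p₂ p₃ : ℝ} (h₂ : p₂ ∈ Set.Icc (0 : ℝ) 1)
    (h₃ : p₃ ∈ Set.Icc (0 : ℝ) 1)
    (e : EdgeIdx n) :
    IsProbabilityMeasure (bern (if e.1.card = 2 then p₂ else p₃)) := by
  split_ifs
  · exact isProbabilityMeasure_bern h₂.1 h₂.2
  · exact isProbabilityMeasure_bern h₃.1 h₃.2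

lemma edgeMeasure_real_miss {p₂ p₃ : ℝ} (h₂ : p₂ ∈ Set.Icc (0 : ℝ) 1)
    (h₃ : p₃ ∈ Set.Icc (0 : ℝ) 1)
    (Q B : Finset (Fin n)) (hQB : Disjoint Q B) (w : Fin n)
    (hw : w ∉ Q ∪ B) :
    (edgeMeasure n p₂ p₃).real {ω | ∀ e ∈ links Q B w, ω e = false} =
      missProb p₂ p₃ Q.card B.card := by
  have := isProbabilityMeasure_edge (n := n) h₂ h₃
  have h1 : ∀ e : EdgeIdx n, (bern (if e.1.card = 2 then p₂ else p₃)).real {false} =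
      if e.1.card = 2 then 1 - p₂ else 1 - p₃ := by
    intro e
    split_ifs
    · exact bern_real_false h₂.2
    · exact bern_real_false h₃.2
  rw [edgeMeasure, measureReal_pi_forall_eq_false, Finset.prod_congr rfl fun e _ => h1 e,
    Finset.prod_ite, Finset.prod_const, Finset.prod_const, missProb,
    card_filter_links Q B hQB w hw 1 (by simp)]
  have h3 : ((links Q B w).filter fun e => ¬ e.1.card = 2) =
      (links Q B w).filter fun e => e.1.card = 2 + 1 := by
    refine Finset.filter_congr fun e _ => ?_
    have := e.2
    omega
  rw [h3, card_filter_links Q B hQB w hw 2 (by simp)]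
  simp

lemma missProb_mem {p₂ p₃ : ℝ} (h₂ : p₂ ∈ Set.Icc (0 : ℝ) 1)
    (h₃ : p₃ ∈ Set.Icc (0 : ℝ) 1)
    (q a : ℕ) : missProb p₂ p₃ q a ∈ Set.Icc (0 : ℝ) 1 := by
  obtain ⟨h1, h2⟩ := h₂
  obtain ⟨h3, h4⟩ := h₃
  refine ⟨mul_nonneg (pow_nonneg (by linarith) _) (pow_nonneg (by linarith) _),
    mul_le_one₀ (pow_le_one₀ (by linarith) (by linarith)) (pow_nonneg (by linarith) _)
      (pow_le_one₀ (by linarith) (by linarith))⟩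

lemma edgeMeasure_real_layerEvent {p₂ p₃ : ℝ} (h₂ : p₂ ∈ Set.Icc (0 : ℝ) 1)
    (h₃ : p₃ ∈ Set.Icc (0 : ℝ) 1)
    (Q B D T : Finset (Fin n)) (hQB : Disjoint Q B)
    (hD : Q ∪ B ⊆ D) (hT : T ⊆ Dᶜ) :
    (edgeMeasure n p₂ p₃).real (layerEvent Q B D T) =
      (1 - missProb p₂ p₃ Q.card B.card) ^ T.card *
        missProb p₂ p₃ Q.card B.card ^ (Dᶜ.card - T.card) := by
  have := isProbabilityMeasure_edge (n := n) h₂ h₃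
  have hw : ∀ w ∈ Dᶜ, w ∉ Q ∪ B := fun w hw h => by simp [hD h] at hw
  rw [layerEvent, edgeMeasure, measureReal_pi_biInter_of_dependsOn _ _ _ (links Q B)]
  · have h1 : ∀ w ∈ Dᶜ, (Measure.pi fun e : EdgeIdx n =>
        bern (if e.1.card = 2 then p₂ else p₃)).real
          {ω | w ∈ T ↔ ∃ e ∈ links Q B w, ω e = true} =
        if w ∈ T then 1 - missProb p₂ p₃ Q.card B.card
        else missProb p₂ p₃ Q.card B.card := by
      intro w hwD
      have h2 := edgeMeasure_real_miss h₂ h₃ Q B hQB w (hw w hwD)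
      rw [edgeMeasure] at h2
      split_ifs with hwT
      · rw [← h2, ← probReal_compl_eq_one_sub (Set.toFinite _).measurableSet]
        congr 1
        ext ω
        simp [hwT]
      · rw [← h2]
        congr 1
        ext ω
        simp [hwT]
    rw [Finset.prod_congr rfl h1, Finset.prod_ite, Finset.prod_const, Finset.prod_const,
      Finset.filter_mem_eq_inter, Finset.inter_eq_right.2 hT, Finset.filter_notMem_eq_sdiff,
      Finset.card_sdiff_of_subset hT]
  · intro w hwD w' hwD' hne
    refine Finset.disjoint_left.2 fun e he he' => ?_
    rw [mem_links] at he he'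
    exact hw w' hwD' (he.2.1 (Finset.mem_erase.2 ⟨hne.symm, he'.1⟩))
  · intro w _ x y hxy
    simp only [Set.mem_ofPred_eq, eq_iff_iff]
    refine iff_congr Iff.rfl (exists_congr fun e => and_congr_right fun he => ?_)
    rw [hxy e he]

lemma card_sdiff_of_mem_links {Q B D : Finset (Fin n)} (hD : Q ∪ B ⊆ D) {w : Fin n} (hw : w ∉ D)
    {e : EdgeIdx n} (he : e ∈ links Q B w) : (e.1 \ D).card = 1 := by
  rw [mem_links] at he
  rw [Finset.card_eq_one]
  refine ⟨w, ?_⟩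
  ext x
  simp only [Finset.mem_sdiff, Finset.mem_singleton]
  refine ⟨fun hx => ?_, fun hx => hx ▸ ⟨he.1, hw⟩⟩
  by_contra hne
  exact hx.2 (hD (he.2.1 (Finset.mem_erase.2 ⟨hne, hx.1⟩)))

lemma two_le_card_sdiff_of_mem_links {Q B D : Finset (Fin n)} {w : Fin n}
    (hw : w ∉ D) {e : EdgeIdx n} (hBD : B ⊆ D) (he : e ∈ links Q B w) :
    2 ≤ (e.1 \ (D \ B)).card := by
  rw [mem_links] at he
  obtain ⟨x, hx, hxQ⟩ := Finset.not_subset.1 he.2.2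
  have hxB : x ∈ B := by simpa [hxQ] using he.2.1 hx
  have hxw : x ≠ w := fun h => hw (h ▸ hBD hxB)
  have : ({x, w} : Finset (Fin n)) ⊆ e.1 \ (D \ B) := by
    intro y hy
    simp only [Finset.mem_insert, Finset.mem_singleton] at hy
    rcases hy with rfl | rfl
    · simp [Finset.mem_of_mem_erase hx, hxB]
    · simp [he.1, hw]
  calc 2 = ({x, w} : Finset (Fin n)).card := (Finset.card_pair hxw).symm
    _ ≤ _ := Finset.card_le_card this

lemma dependsOn_layerEvent (Q B D T : Finset (Fin n)) :
    DependsOn (fun ω => ω ∈ layerEvent Q B D T)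
      ({e | ∃ w ∉ D, e ∈ links Q B w} : Set (EdgeIdx n)) := by
  intro x y hxy
  simp only [layerEvent, Set.mem_iInter, Set.mem_ofPred_eq, eq_iff_iff]
  refine forall₂_congr fun w hw => iff_congr Iff.rfl
    (exists_congr fun e => and_congr_right fun he => ?_)
  rw [hxy e ⟨w, by simpa using hw, he⟩]

lemma dependsOn_chainEvent (b h k : ℕ) (Q B D : Finset (Fin n)) (hBD : B ⊆ D) :
    DependsOn (fun ω => ω ∈ chainEvent b h k Q B D)
      ({e | 2 ≤ (e.1 \ (D \ B)).card} : Set (EdgeIdx n)) := by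
  induction k generalizing Q B D with
  | zero => intro x y _; simp [chainEvent]
  | succ k ih =>
    intro x y hxy
    simp only [chainEvent, Set.mem_iUnion, Set.mem_inter_iff, eq_iff_iff]
    refine exists_congr fun T => exists_congr fun hT => and_congr ?_ ?_
    · exact iff_of_eq (dependsOn_layerEvent Q B D T fun e he => by
        obtain ⟨w, hw, he⟩ := he
        exact hxy e (two_le_card_sdiff_of_mem_links hw hBD he))
    · refine iff_of_eq (ih _ T (D ∪ T) Finset.subset_union_right fun e he => hxy e ?_)
      have hTD : (D ∪ T) \ T = D := by
        rw [Finset.union_sdiff_right, Finset.sdiff_eq_self_iff_disjoint]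
        exact (Finset.disjoint_left.2 fun a ha haD =>
          Finset.mem_compl.1 ((Finset.mem_powersetCard.1 hT).1 ha) haD).symm
      rw [Set.mem_ofPred_eq, hTD] at he
      exact he.trans (Finset.card_le_card (Finset.sdiff_subset_sdiff le_rfl
        Finset.sdiff_subset))

/-- One exploration step: the next layer has exactly `b` vertices, and then an event of probability
at least `c`, not depending on the edges used in the step, occurs. -/
lemma le_edgeMeasure_real_iUnion_layerEvent {p₂ p₃ : ℝ} (h₂ : p₂ ∈ Set.Icc (0 : ℝ) 1)
    (h₃ : p₃ ∈ Set.Icc (0 : ℝ) 1) (b : ℕ) (Q B D : Finset (Fin n)) (hQB : Disjoint Q B)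
    (hD : Q ∪ B ⊆ D) (F : Finset (Fin n) → Set (EdgeIdx n → Bool)) (c : ℝ)
    (hF : ∀ T ∈ Finset.powersetCard b Dᶜ,
      DependsOn (fun ω => ω ∈ F T) ({e | 2 ≤ (e.1 \ D).card} : Set (EdgeIdx n)))
    (hc : ∀ T ∈ Finset.powersetCard b Dᶜ, c ≤ (edgeMeasure n p₂ p₃).real (F T)) :
    ((n - D.card).choose b * ((1 - missProb p₂ p₃ Q.card B.card) ^ b *
      missProb p₂ p₃ Q.card B.card ^ (n - D.card - b))) * c ≤
    (edgeMeasure n p₂ p₃).real (⋃ T ∈ Finset.powersetCard b Dᶜ, layerEvent Q B D T ∩ F T) := by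
  have := isProbabilityMeasure_edge (n := n) h₂ h₃
  have hfin : IsProbabilityMeasure (edgeMeasure n p₂ p₃) := by
    unfold edgeMeasure; infer_instance
  have hcard : Dᶜ.card = n - D.card := by simp [Finset.card_compl]
  have hu := missProb_mem h₂ h₃ Q.card B.card
  rw [measureReal_biUnion_finset]
  · rw [← hcard, ← Finset.card_powersetCard, mul_assoc, ← nsmul_eq_mul]
    refine Finset.card_nsmul_le_sum _ _ _ fun T hT => ?_
    obtain ⟨hTD, hTb⟩ := Finset.mem_powersetCard.1 hT
    have hind : (edgeMeasure n p₂ p₃).real (layerEvent Q B D T ∩ F T) =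
        (edgeMeasure n p₂ p₃).real (layerEvent Q B D T) * (edgeMeasure n p₂ p₃).real (F T) := by
      refine measureReal_pi_inter_of_dependsOn _
        (E := Finset.univ.filter fun e => (e.1 \ D).card = 1)
        (F := Finset.univ.filter fun e => 2 ≤ (e.1 \ D).card) ?_ ?_ ?_
      · exact Finset.disjoint_filter.2 fun e _ h1 h2 => by omega
      · refine (dependsOn_layerEvent Q B D T).mono ?_
        rintro e ⟨w, hw, he⟩
        simpa using card_sdiff_of_mem_links hD hw he
      · simpa using hF T hT
    rw [hind, edgeMeasure_real_layerEvent h₂ h₃ Q B D T hQB hD hTD, hTb]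
    exact mul_le_mul_of_nonneg_left (hc T hT)
      (mul_nonneg (pow_nonneg (by linarith [hu.2]) _) (pow_nonneg hu.1 _))
  · intro T hT T' hT' hne
    refine Set.disjoint_left.2 fun ω h h' => hne ?_
    have h1 := h.1
    have h2 := h'.1
    simp only [layerEvent, Set.mem_iInter, Set.mem_ofPred_eq] at h1 h2
    have hTD := (Finset.mem_powersetCard.1 hT).1
    have hTD' := (Finset.mem_powersetCard.1 hT').1
    ext w
    exact ⟨fun hw => (h2 w (hTD hw)).2 ((h1 w (hTD hw)).1 hw),
      fun hw => (h1 w (hTD' hw)).2 ((h2 w (hTD' hw)).1 hw)⟩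
  · exact fun _ _ => (Set.toFinite _).measurableSet

/-- The contribution of one layer to the lower bound for `chainEvent`. -/
noncomputable def stepBound (n b : ℕ) (p₂ p₃ : ℝ) (d q a : ℕ) : ℝ :=
  (n - d).choose b * ((1 - missProb p₂ p₃ q a) ^ b * missProb p₂ p₃ q a ^ (n - d - b))

lemma le_edgeMeasure_real_chainEvent {p₂ p₃ : ℝ} (h₂ : p₂ ∈ Set.Icc (0 : ℝ) 1)
    (h₃ : p₃ ∈ Set.Icc (0 : ℝ) 1) (b J d : ℕ) (hb : 0 < b) (k i : ℕ) (Q B D : Finset (Fin n))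
    (hQB : Disjoint Q B) (hD : Q ∪ B ⊆ D) (hQ : Q.card = min i J * b) (hB : B.card = b)
    (hDc : D.card = d + i * b) :
    ∏ j ∈ Finset.range k, stepBound n b p₂ p₃ (d + (i + j) * b) (min (i + j) J * b) b ≤
      (edgeMeasure n p₂ p₃).real (chainEvent b (J * b) k Q B D) := by
  have := isProbabilityMeasure_edge (n := n) h₂ h₃
  have hfin : IsProbabilityMeasure (edgeMeasure n p₂ p₃) := by
    unfold edgeMeasure; infer_instance
  induction k generalizing i Q B D with
  | zero => simp [chainEvent]
  | succ k ih =>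
    have hmem : ∀ T ∈ Finset.powersetCard b Dᶜ, Disjoint D T := fun T hT =>
      (Finset.disjoint_left.2 fun a ha haD =>
          Finset.mem_compl.1 ((Finset.mem_powersetCard.1 hT).1 ha) haD).symm
    have h := le_edgeMeasure_real_iUnion_layerEvent h₂ h₃ b Q B D hQB hD
      (fun T => chainEvent b (J * b) k (if Q.card < J * b then Q ∪ B else Q) T (D ∪ T))
      (∏ j ∈ Finset.range k,
        stepBound n b p₂ p₃ (d + (i + 1 + j) * b) (min (i + 1 + j) J * b) b) ?_ ?_
    · rw [Finset.prod_range_succ', mul_comm, chainEvent]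
      refine le_trans (le_of_eq ?_) h
      rw [hQ, hB, hDc, stepBound, add_zero]
      congr 1
      refine Finset.prod_congr rfl fun j _ => ?_
      rw [add_assoc i 1 j, add_comm 1 j]
    · intro T hT
      have h1 := dependsOn_chainEvent b (J * b) k (if Q.card < J * b then Q ∪ B else Q) T (D ∪ T)
        Finset.subset_union_right
      rwa [Finset.union_sdiff_right, Finset.sdiff_eq_self_of_disjoint (hmem T hT)] at h1
    · intro T hT
      have hTb := (Finset.mem_powersetCard.1 hT).2
      have hsub : (if Q.card < J * b then Q ∪ B else Q) ⊆ D := by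
        split_ifs
        · exact hD
        · exact Finset.subset_union_left.trans hD
      refine ih (i + 1) _ T (D ∪ T) (Finset.disjoint_of_subset_left hsub (hmem T hT))
        (Finset.union_subset_union_left hsub) ?_ hTb ?_
      · rw [hQ]
        by_cases hi : i < J
        · rw [min_eq_left hi.le, if_pos (Nat.mul_lt_mul_of_pos_right hi hb),
            Finset.card_union_of_disjoint hQB, hQ, hB, min_eq_left hi.le, min_eq_left (by omega)]
          ring
        · rw [min_eq_right (by omega), if_neg (lt_irrefl _), hQ, min_eq_right (by omega),
            min_eq_right (by omega)]
      · rw [Finset.card_union_of_disjoint (hmem T hT), hDc, hTb]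
        ring

end Layers

section Propagation

variable {n : ℕ} {ω : EdgeIdx n → Bool} {S : Finset (Fin n)}

/-- `R` is the vertex set covered by some propagation sequence from `S`. -/
def Attainable (ω : EdgeIdx n → Bool) (S R : Finset (Fin n)) : Prop :=
  ∃ k f, IsPropSeqFrom ω S k f ∧ S ∪ (Finset.range k).biUnion f = R

lemma attainable_self : Attainable ω S S :=
  ⟨0, fun _ => ∅, ⟨by simp, by simp⟩, by simp⟩

lemma Attainable.subset_propComponent {R : Finset (Fin n)} (h : Attainable ω S R) :
    (R : Set (Fin n)) ⊆ propComponent ω S := by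
  obtain ⟨k, f, hf, rfl⟩ := h
  intro x hx
  simp only [Finset.coe_union, Set.mem_union, Finset.mem_coe, Finset.mem_biUnion,
    Finset.mem_range] at hx
  rcases hx with hx | ⟨i, hi, hx⟩
  · exact Or.inl hx
  · exact Or.inr ⟨k, f, hf, i, hi, hx⟩

lemma Attainable.union_edge {R e : Finset (Fin n)} (h : Attainable ω S R) (he : IsEdge ω e)
    (hc : (e ∩ R).card = e.card - 1) : Attainable ω S (R ∪ e) := by
  obtain ⟨k, f, ⟨hf1, hf2⟩, rfl⟩ := h
  have hlt : ∀ i < k, Function.update f k e i = f i := fun i hi =>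
    Function.update_of_ne hi.ne _ _
  have hbi : ∀ l ≤ k, (Finset.range l).biUnion (Function.update f k e) =
      (Finset.range l).biUnion f := fun l hl =>
    Finset.biUnion_congr rfl fun i hi => hlt i ((Finset.mem_range.1 hi).trans_le hl)
  refine ⟨k + 1, Function.update f k e, ⟨fun i hi => ?_, fun l hl => ?_⟩, ?_⟩
  · rcases Nat.lt_succ_iff_lt_or_eq.1 hi with hi | rfl
    · rw [hlt i hi]; exact hf1 i hi
    · simpa using he
  · rcases Nat.lt_succ_iff_lt_or_eq.1 hl with hl | rfl
    · rw [hlt l hl, hbi l hl.le]; exact hf2 l hl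
    · rw [hbi l le_rfl]; simpa using hc
  · rw [Finset.range_add_one, Finset.biUnion_insert, hbi k le_rfl, Function.update_self,
      Finset.union_comm e, Finset.union_assoc]

lemma Attainable.union_layer {Q B D T : Finset (Fin n)} (h : Attainable ω S D)
    (hD : Q ∪ B ⊆ D) (hT : T ⊆ Dᶜ) (hω : ω ∈ layerEvent Q B D T) : Attainable ω S (D ∪ T) := by
  have key : ∀ U ⊆ T, Attainable ω S (D ∪ U) := by
    intro U
    induction U using Finset.induction_on with
    | empty => intro _; simpa using h
    | insert w U hwU ih =>
      intro hU
      have hwT : w ∈ T := hU (Finset.mem_insert_self _ _)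
      have hwD : w ∉ D := Finset.mem_compl.1 (hT hwT)
      simp only [layerEvent, Set.mem_iInter, Set.mem_ofPred_eq] at hω
      obtain ⟨e, he, hωe⟩ := (hω w (hT hwT)).1 hwT
      rw [mem_links] at he
      have hsub : e.1.erase w ⊆ D ∪ U := (he.2.1.trans hD).trans Finset.subset_union_left
      have hint : e.1 ∩ (D ∪ U) = e.1.erase w := by
        ext x
        simp only [Finset.mem_inter, Finset.mem_erase]
        refine ⟨fun hx => ⟨?_, hx.1⟩, fun hx => ⟨hx.2, hsub (Finset.mem_erase.2 hx)⟩⟩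
        rintro rfl
        simp [hwD, hwU] at hx
      have := (ih ((Finset.subset_insert _ _).trans hU)).union_edge (e := e.1) ⟨e.2, hωe⟩
        (by rw [hint, Finset.card_erase_of_mem he.1])
      convert! this using 1
      rw [← Finset.insert_erase he.1, Finset.union_insert, Finset.union_insert,
        Finset.union_eq_left.2 hsub]
  exact key T subset_rfl

lemma exists_attainable_of_mem_chainEvent (b h k : ℕ) (Q B D : Finset (Fin n)) (hD : Q ∪ B ⊆ D)
    (hatt : Attainable ω S D) (hω : ω ∈ chainEvent b h k Q B D) :
    ∃ R, Attainable ω S R ∧ D.card + k * b ≤ R.card := by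
  induction k generalizing Q B D with
  | zero => exact ⟨D, hatt, by simp⟩
  | succ k ih =>
    simp only [chainEvent, Set.mem_iUnion] at hω
    obtain ⟨T, hT, hω1, hω2⟩ := hω
    obtain ⟨hTD, hTb⟩ := Finset.mem_powersetCard.1 hT
    have hdis : Disjoint D T := (Finset.disjoint_left.2 fun a ha haD =>
          Finset.mem_compl.1 (hTD ha) haD).symm
    have hsub : (if Q.card < h then Q ∪ B else Q) ⊆ D := by
      split_ifs
      · exact hD
      · exact Finset.subset_union_left.trans hD
    obtain ⟨R, hR, hc⟩ := ih _ T (D ∪ T) (Finset.union_subset_union_left hsub)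
      (hatt.union_layer hD hTD hω1) hω2
    refine ⟨R, hR, ?_⟩
    rw [Finset.card_union_of_disjoint hdis, hTb] at hc
    linarith

/-- Lower bound for the probability that the propagation component of a vertex has at least
`1 + (k + 1) * b` vertices. -/
lemma le_edgeMeasure_real_propComponent {p₂ p₃ : ℝ} (h₂ : p₂ ∈ Set.Icc (0 : ℝ) 1)
    (h₃ : p₃ ∈ Set.Icc (0 : ℝ) 1) (b J k : ℕ) (hb : 0 < b) (v : Fin n) :
    stepBound n b p₂ p₃ 1 0 1 * ∏ j ∈ Finset.range k,
        stepBound n b p₂ p₃ (1 + b + j * b) (min j J * b) b ≤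
      (edgeMeasure n p₂ p₃).real {ω | 1 + (k + 1) * b ≤ (propComponent ω {v}).ncard} := by
  have := isProbabilityMeasure_edge (n := n) h₂ h₃
  have hfin : IsProbabilityMeasure (edgeMeasure n p₂ p₃) := by
    unfold edgeMeasure; infer_instance
  have hmem : ∀ T ∈ Finset.powersetCard b ({v} : Finset (Fin n))ᶜ, Disjoint {v} T := fun T hT =>
    (Finset.disjoint_left.2 fun a ha haD =>
      Finset.mem_compl.1 ((Finset.mem_powersetCard.1 hT).1 ha) haD).symm
  have h := le_edgeMeasure_real_iUnion_layerEvent h₂ h₃ b ∅ {v} {v} (by simp) (by simp)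
    (fun T => chainEvent b (J * b) k ∅ T ({v} ∪ T))
    (∏ j ∈ Finset.range k, stepBound n b p₂ p₃ (1 + b + j * b) (min j J * b) b) ?_ ?_
  · refine h.trans (measureReal_mono ?_)
    intro ω hω
    simp only [Set.mem_iUnion] at hω
    obtain ⟨T, hT, hω1, hω2⟩ := hω
    have hTb := (Finset.mem_powersetCard.1 hT).2
    obtain ⟨R, hR, hc⟩ := exists_attainable_of_mem_chainEvent (S := {v}) b (J * b) k ∅ T ({v} ∪ T)
      (by simp) (attainable_self.union_layer (by simp) (Finset.mem_powersetCard.1 hT).1 hω1) hω2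
    rw [Finset.card_union_of_disjoint (hmem T hT), Finset.card_singleton, hTb] at hc
    calc 1 + (k + 1) * b ≤ R.card := by linarith
      _ = (R : Set (Fin n)).ncard := (Set.ncard_coe_finset R).symm
      _ ≤ _ := Set.ncard_le_ncard hR.subset_propComponent (Set.toFinite _)
  · intro T hT
    have h1 := dependsOn_chainEvent b (J * b) k ∅ T ({v} ∪ T) Finset.subset_union_right
    rwa [Finset.union_sdiff_right, Finset.sdiff_eq_self_of_disjoint (hmem T hT)] at h1
  · intro T hT
    have hTb := (Finset.mem_powersetCard.1 hT).2
    have h1 := le_edgeMeasure_real_chainEvent h₂ h₃ b J (1 + b) hb k 0 ∅ T ({v} ∪ T) (by simp)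
      (by simp) (by simp) hTb
      (by rw [Finset.card_union_of_disjoint (hmem T hT), hTb]; simp)
    simpa using h1

/-- The expected number of vertices with a large propagation component. -/
lemma ofReal_mul_le_lintegral_goodCount (n : ℕ) (ε r c : ℝ)
    (hc : ∀ v : Fin n, c ≤ (hypMeasure n ε r).real
      {ω | K0 ε r * Real.log n ≤ ((propComponent ω {v}).ncard : ℝ)}) :
    ENNReal.ofReal (n * c) ≤ ∫⁻ ω, (goodCount n ε r ω : ℝ≥0∞) ∂(hypMeasure n ε r) := by
  classical
  have hfin : IsFiniteMeasure (hypMeasure n ε r) := by unfold hypMeasure; infer_instance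
  have h1 : ∀ ω, (goodCount n ε r ω : ℝ≥0∞) = ∑ v : Fin n, Set.indicator
      {ω | K0 ε r * Real.log n ≤ ((propComponent ω {v}).ncard : ℝ)} 1 ω := by
    intro ω
    rw [goodCount, Set.ncard_eq_toFinset_card', Finset.card_eq_sum_ones, Nat.cast_sum,
      Set.toFinset_ofPred, Finset.sum_filter]
    refine Finset.sum_congr rfl fun v _ => ?_
    simp [Set.indicator_apply]
  simp_rw [h1]
  rw [lintegral_finsetSum]
  · have h2 : ∀ v : Fin n, ENNReal.ofReal c ≤ ∫⁻ ω, Set.indicator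
        {ω | K0 ε r * Real.log n ≤ ((propComponent ω {v}).ncard : ℝ)} 1 ω
          ∂(hypMeasure n ε r) := by
      intro v
      rw [lintegral_indicator_one (Set.toFinite _).measurableSet]
      exact (ENNReal.ofReal_le_iff_le_toReal (measure_ne_top _ _)).2 (hc v)
    calc ENNReal.ofReal (n * c) = ∑ _v : Fin n, ENNReal.ofReal c := by
          rw [ENNReal.ofReal_mul (by positivity)]; simp
      _ ≤ _ := Finset.sum_le_sum fun v _ => h2 v
  · exact fun v _ => measurable_of_finite _

end Propagation

section Estimates

lemma exp_neg_le_one_sub {p δ : ℝ} (hp : 0 ≤ p) (hδ : p ≤ δ) (hp2 : p ≤ 1 / 2) :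
    Real.exp (-(p * (1 + 2 * δ))) ≤ 1 - p := by
  have h1 : (1 : ℝ) ≤ (1 - p) * (1 + p * (1 + 2 * δ)) := by
    nlinarith [mul_nonneg hp (sub_nonneg.2 hδ), mul_nonneg hp (sub_nonneg.2 hp2),
      mul_nonneg (mul_nonneg hp (sub_nonneg.2 hδ)) (sub_nonneg.2 hp2)]
  have h2 : 1 + p * (1 + 2 * δ) ≤ Real.exp (p * (1 + 2 * δ)) := by
    linarith [Real.add_one_le_exp (p * (1 + 2 * δ))]
  rw [Real.exp_neg, inv_le_iff_one_le_mul₀ (Real.exp_pos _)]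
  exact h1.trans (mul_le_mul_of_nonneg_left h2 (by linarith))

lemma mul_one_sub_le_one_sub_exp_neg {y : ℝ} (hy : 0 ≤ y) :
    y * (1 - y) ≤ 1 - Real.exp (-y) := by
  have h : Real.exp (-y) ≤ 1 / (1 + y) := by
    rw [Real.exp_neg, ← one_div]
    exact one_div_le_one_div_of_le (by linarith) (by linarith [Real.add_one_le_exp y])
  have h2 : 1 / (1 + y) ≤ 1 - y * (1 - y) := by
    rw [div_le_iff₀ (by linarith)]
    nlinarith [pow_nonneg hy 3]
  linarith

lemma factorial_le_exp_mul (b : ℕ) (hb : 0 < b) :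
    (b.factorial : ℝ) ≤ Real.exp 1 * b * (b ^ b * Real.exp (-b)) := by
  induction b, hb using Nat.le_induction with
  | base => simp [← Real.exp_add]
  | succ b hb ih =>
    have hb' : (0 : ℝ) < b := by exact_mod_cast hb
    have hlog : 1 ≤ (b + 1) * Real.log ((b + 1) / b) := by
      have := Real.one_sub_inv_le_log_of_pos (x := ((b : ℝ) + 1) / b) (by positivity)
      calc (1 : ℝ) = (b + 1) * (1 - (((b : ℝ) + 1) / b)⁻¹) := by field_simp; ring
        _ ≤ _ := by gcongr
    have hexp : Real.exp 1 ≤ (((b : ℝ) + 1) / b) ^ (b + 1) := by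
      calc Real.exp 1 ≤ Real.exp ((b + 1 : ℕ) * Real.log ((b + 1) / b)) := by
            apply Real.exp_le_exp.2; push_cast; exact hlog
        _ = _ := by rw [Real.exp_nat_mul, Real.exp_log (by positivity)]
    rw [div_pow, le_div_iff₀ (by positivity)] at hexp
    rw [Nat.factorial_succ]
    push_cast
    calc ((b : ℝ) + 1) * b.factorial
        ≤ (b + 1) * (Real.exp 1 * b * (b ^ b * Real.exp (-b))) := by gcongr
      _ = (b + 1) * Real.exp (-b) * (Real.exp 1 * b ^ (b + 1)) := by ring
      _ ≤ (b + 1) * Real.exp (-b) * ((b + 1) ^ (b + 1)) := by gcongr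
      _ = Real.exp 1 * (b + 1) * ((b + 1) ^ (b + 1) * Real.exp (-(b + 1))) := by
          rw [neg_add, Real.exp_add, Real.exp_neg 1]
          field_simp

lemma half_le_mul_mul {b : ℕ} {x y : ℝ} (hx : 0 ≤ x) (hy : 0 ≤ y)
    (h : (b + 2) * (x + y) ≤ 1 / 2) :
    1 / 2 ≤ (1 - x) ^ b * (1 - y) ^ b * (1 - 2 * y) := by
  have hb : (0 : ℝ) ≤ b := Nat.cast_nonneg b
  have hbx := mul_nonneg hb hx
  have hby := mul_nonneg hb hy
  have h1 : 1 - b * x ≤ (1 - x) ^ b := by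
    have := one_add_mul_le_pow (a := -x) (by nlinarith) b
    simpa [sub_eq_add_neg] using this
  have h2 : 1 - b * y ≤ (1 - y) ^ b := by
    have := one_add_mul_le_pow (a := -y) (by nlinarith) b
    simpa [sub_eq_add_neg] using this
  calc (1 / 2 : ℝ) ≤ (1 - b * x) * (1 - b * y) * (1 - 2 * y) := by
        have h3 : 1 - b * x - b * y ≤ (1 - b * x) * (1 - b * y) := by
          nlinarith [mul_nonneg hbx hby]
        have h4 : (1 - b * x - b * y) * (1 - 2 * y) ≤ (1 - b * x) * (1 - b * y) * (1 - 2 * y) :=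
          mul_le_mul_of_nonneg_right h3 (by nlinarith)
        refine le_trans ?_ h4
        nlinarith [mul_nonneg hbx hy, mul_nonneg hby hy]
    _ ≤ _ := by
        have : 0 ≤ 1 - b * x := by nlinarith
        have : 0 ≤ 1 - b * y := by nlinarith
        have : 0 ≤ 1 - 2 * y := by nlinarith
        have : 0 ≤ (1 - x) ^ b := by linarith
        gcongr

/-- Poisson-type lower bound for `stepBound`. -/
lemma poisson_le_stepBound {n b d q a : ℕ} {p₂ p₃ μ : ℝ} (hn : 2 ≤ n)
    (h₂ : p₂ ∈ Set.Icc (0 : ℝ) (1 / n)) (h₃ : p₃ ∈ Set.Icc (0 : ℝ) (1 / n))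
    (hμ : μ = n * (a * p₂ + ((q + a).choose 2 - q.choose 2 : ℕ) * p₃))
    (hsmall : ((b : ℝ) + 2) * (d + b + μ) ≤ n / 2) :
    1 / 2 * (Real.exp (-μ) * (μ ^ b / b.factorial)) ≤ stepBound n b p₂ p₃ d q a := by
  have hn0 : (0 : ℝ) < n := by positivity
  have hn2 : (2 : ℝ) ≤ n := by exact_mod_cast hn
  obtain ⟨h20, h21⟩ := h₂
  obtain ⟨h30, h31⟩ := h₃
  have hinv : 1 / (n : ℝ) ≤ 1 / 2 := one_div_le_one_div_of_le two_pos hn2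
  set c : ℕ := (q + a).choose 2 - q.choose 2
  have hμ0 : 0 ≤ μ := by rw [hμ]; positivity
  set x : ℝ := (d + b) / n with hx
  set y : ℝ := μ / n with hy
  have hx0 : 0 ≤ x := by positivity
  have hy0 : 0 ≤ y := by positivity
  have hyeq : y = a * p₂ + c * p₃ := by rw [hy, hμ]; field_simp
  have hμy : μ = n * y := by rw [hy]; field_simp
  have hxy : ((b : ℝ) + 2) * (x + y) ≤ 1 / 2 := by
    rw [hx, hy, ← add_div, ← mul_div_assoc, div_le_iff₀ hn0]
    linarith
  have hy1 : y ≤ 1 / 2 := by nlinarith [mul_nonneg (Nat.cast_nonneg (α := ℝ) b) (add_nonneg hx0 hy0)]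
  set u := missProb p₂ p₃ q a with hu
  have hu01 : u ∈ Set.Icc (0 : ℝ) 1 :=
    missProb_mem ⟨h20, by linarith⟩ ⟨h30, by linarith⟩ q a
  have hupper : u ≤ Real.exp (-y) := by
    have e2 : 1 - p₂ ≤ Real.exp (-p₂) := Real.one_sub_le_exp_neg _
    have e3 : 1 - p₃ ≤ Real.exp (-p₃) := Real.one_sub_le_exp_neg _
    have : Real.exp (-y) = Real.exp (-p₂) ^ a * Real.exp (-p₃) ^ c := by
      rw [← Real.exp_nat_mul, ← Real.exp_nat_mul, ← Real.exp_add, hyeq]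
      congr 1; ring
    rw [this, hu, missProb]
    have : 0 ≤ 1 - p₂ := by linarith
    have : 0 ≤ 1 - p₃ := by linarith
    gcongr
  have hlower : Real.exp (-(y * (1 + 2 * (1 / n)))) ≤ u := by
    have e2 := exp_neg_le_one_sub h20 h21 (h21.trans hinv)
    have e3 := exp_neg_le_one_sub h30 h31 (h31.trans hinv)
    have : Real.exp (-(y * (1 + 2 * (1 / n)))) =
        Real.exp (-(p₂ * (1 + 2 * (1 / n)))) ^ a * Real.exp (-(p₃ * (1 + 2 * (1 / n)))) ^ c := by
      rw [← Real.exp_nat_mul, ← Real.exp_nat_mul, ← Real.exp_add, hyeq]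
      congr 1; ring
    rw [this, hu, missProb]
    have : 0 ≤ 1 - p₂ := by linarith
    gcongr
  have hpow : Real.exp (-μ) * (1 - 2 * y) ≤ u ^ (n - d - b) := by
    calc Real.exp (-μ) * (1 - 2 * y) ≤ Real.exp (-μ) * Real.exp (-(2 * y)) := by
          gcongr; exact Real.one_sub_le_exp_neg _
      _ = Real.exp (-(y * (1 + 2 * (1 / n)))) ^ n := by
          rw [← Real.exp_nat_mul, ← Real.exp_add, hμy]
          congr 1; field_simp; ring
      _ ≤ u ^ n := by gcongr
      _ ≤ u ^ (n - d - b) := pow_le_pow_of_le_one hu01.1 hu01.2 (by omega)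
  have hhit : y * (1 - y) ≤ 1 - u :=
    (mul_one_sub_le_one_sub_exp_neg hy0).trans (by linarith)
  have hdb : (d : ℝ) + b ≤ n := by
    have : ((b : ℝ) + 2) * (d + b) ≤ n / 2 := by nlinarith [Nat.cast_nonneg (α := ℝ) b]
    nlinarith [mul_nonneg (Nat.cast_nonneg (α := ℝ) b)
      (add_nonneg (Nat.cast_nonneg (α := ℝ) d) (Nat.cast_nonneg (α := ℝ) b)),
      add_nonneg (Nat.cast_nonneg (α := ℝ) d) (Nat.cast_nonneg (α := ℝ) b)]
  have hdbN : d + b ≤ n := by exact_mod_cast hdb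
  have hx1 : x ≤ 1 := by rw [hx, div_le_one hn0]; exact hdb
  have hchoose : (n * (1 - x)) ^ b / b.factorial ≤ ((n - d).choose b : ℝ) := by
    rw [div_le_iff₀ (by positivity)]
    have h1 := Nat.pow_sub_le_descFactorial (n - d) b
    rw [Nat.descFactorial_eq_factorial_mul_choose] at h1
    have h2 : ((n - d + 1 - b : ℕ) : ℝ) ^ b ≤ (n - d).choose b * b.factorial := by
      rw [mul_comm]; exact_mod_cast h1
    refine le_trans ?_ h2
    have h3 : (n : ℝ) * (1 - x) ≤ ((n - d + 1 - b : ℕ) : ℝ) := by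
      have : (n : ℝ) * (1 - x) = ((n - (d + b) : ℕ) : ℝ) := by
        rw [Nat.cast_sub hdbN, hx]; push_cast; field_simp
      rw [this]
      exact_mod_cast (by omega)
    have : 0 ≤ (n : ℝ) * (1 - x) := mul_nonneg hn0.le (by linarith)
    gcongr
  have hhalf := half_le_mul_mul hx0 hy0 hxy
  rw [stepBound, ← hu]
  have k1 : 0 ≤ y * (1 - y) := mul_nonneg hy0 (by linarith)
  have k2 : 0 ≤ Real.exp (-μ) * (1 - 2 * y) :=
    mul_nonneg (Real.exp_pos _).le (by linarith)
  have k3 : 0 ≤ 1 - u := k1.trans hhit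
  calc 1 / 2 * (Real.exp (-μ) * (μ ^ b / b.factorial))
      ≤ ((1 - x) ^ b * (1 - y) ^ b * (1 - 2 * y)) * (Real.exp (-μ) * (μ ^ b / b.factorial)) := by
        gcongr
    _ = (n * (1 - x)) ^ b / b.factorial * ((y * (1 - y)) ^ b * (Real.exp (-μ) * (1 - 2 * y))) := by
        rw [hμy, mul_pow, mul_pow, mul_pow]; ring
    _ ≤ _ := by gcongr

/-- Lower bound for one layer in terms of the Poisson rate function. -/
lemma exp_neg_le_stepBound {n b d q : ℕ} {ε r : ℝ} (hε0 : 0 < ε) (hε1 : ε < 1) (hr : 0 < r)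
    (hb : 0 < b) (hn : 2 ≤ n) (hL0 : 0 < Real.log n) (hLr : r ≤ Real.log n)
    (hLb : r * b ^ 2 ≤ Real.log n) {l : ℝ} (hl : l = 1 - ε + r * q / Real.log n) (hl1 : l ≤ 1)
    (hsmall : ((b : ℝ) + 2) * (d + 2 * b + 1) ≤ n / 2) :
    Real.exp (-(b * (l - 1 - Real.log l) + Real.log (16 * b))) ≤
      stepBound n b ((1 - ε) / n) (r / (n * Real.log n)) d q b := by
  have hn0 : (0 : ℝ) < n := by positivity
  have hb0 : (0 : ℝ) < b := by exact_mod_cast hb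
  set L := Real.log n with hL
  have hlpos : 0 < l := by
    rw [hl]
    have : 0 ≤ r * q / L := by positivity
    linarith
  have hch : (((q + b).choose 2 - q.choose 2 : ℕ) : ℝ) = q * b + b * (b - 1) / 2 := by
    rw [Nat.cast_sub (Nat.choose_le_choose 2 (by omega)), Nat.cast_choose_two,
      Nat.cast_choose_two]
    push_cast; ring
  set μ : ℝ := n * (b * ((1 - ε) / n) +
    ((q + b).choose 2 - q.choose 2 : ℕ) * (r / (n * L))) with hμ
  have hμ' : μ = b * l + r * (b * (b - 1) / 2) / L := by
    rw [hμ, hch, hl]; field_simp; ring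
  have hb1 : (1 : ℝ) ≤ b := by exact_mod_cast hb
  have hbb : 0 ≤ (b : ℝ) * (b - 1) / 2 := by
    have : 0 ≤ (b : ℝ) - 1 := by linarith
    positivity
  have hlow : b * l ≤ μ := by
    rw [hμ']
    have : 0 ≤ r * (b * (b - 1) / 2) / L := by positivity
    linarith
  have hup : μ ≤ b * l + 1 := by
    rw [hμ']
    have : r * (b * (b - 1) / 2) / L ≤ 1 := by
      rw [div_le_one hL0]
      refine le_trans ?_ hLb
      gcongr
      nlinarith
    linarith
  have hp := poisson_le_stepBound (b := b) (d := d) (q := q) (a := b) (p₂ := (1 - ε) / n)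
    (p₃ := r / (n * L)) hn ⟨div_nonneg (by linarith) hn0.le, by gcongr; linarith⟩
    ⟨by positivity, by
      rw [div_le_div_iff₀ (by positivity) hn0]
      nlinarith⟩ hμ (by
      refine le_trans (mul_le_mul_of_nonneg_left ?_ (by positivity)) hsmall
      nlinarith)
  refine le_trans ?_ hp
  have he : Real.exp 1 * Real.exp 1 ≤ 8 := by
    have := Real.exp_one_lt_d9
    nlinarith [Real.exp_pos 1]
  calc Real.exp (-(b * (l - 1 - Real.log l) + Real.log (16 * b)))
      = 1 / 2 * (Real.exp (-(b * l)) * ((b * l) ^ b /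
          (8 * b * (b ^ b * Real.exp (-b))))) := by
        have e1 : l ^ b = Real.exp (b * Real.log l) := by
          rw [Real.exp_nat_mul, Real.exp_log hlpos]
        have e2 : -(b * (l - 1 - Real.log l) + Real.log (16 * b)) =
            -(b * l) + b + b * Real.log l + -Real.log (16 * b) := by ring
        rw [e2, Real.exp_add, Real.exp_add, Real.exp_add, ← e1, Real.exp_neg (Real.log _),
          Real.exp_log (by positivity), mul_pow, Real.exp_neg (b : ℝ)]
        field_simp
        norm_num
    _ ≤ 1 / 2 * (Real.exp (-(b * l)) * ((b * l) ^ b /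
          (Real.exp 1 * Real.exp 1 * b * (b ^ b * Real.exp (-b))))) := by
        gcongr
    _ = 1 / 2 * (Real.exp (-(b * l + 1)) * ((b * l) ^ b /
          (Real.exp 1 * b * (b ^ b * Real.exp (-b))))) := by
        rw [neg_add, Real.exp_add, Real.exp_neg 1]
        field_simp
    _ ≤ 1 / 2 * (Real.exp (-μ) * (μ ^ b / b.factorial)) := by
        have := factorial_le_exp_mul b hb
        gcongr

/-- A Riemann sum of the Poisson rate function is bounded by the integral. -/
lemma sum_rate_le {s h : ℝ} (hs : 0 < s) (hh : 0 < h) (J k : ℕ) (hJ : s + J * h ≤ 1)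
    (hJ' : 1 ≤ s + (J + 1) * h) (hk : J ≤ k) :
    ∑ j ∈ Finset.range (k + 1), h * ((s + (min j J : ℕ) * h) - 1 -
        Real.log (s + (min j J : ℕ) * h)) ≤
      (1 - s ^ 2) / 2 + s * Real.log s + h ^ 2 / 2 + h * (s - 1 - Real.log s) +
        k * (h ^ 2 / 2 + h ^ 3 / s) := by
  have main : ∀ m : ℕ, ∑ j ∈ Finset.range (m + 1), h * ((s + (min j J : ℕ) * h) - 1 -
        Real.log (s + (min j J : ℕ) * h)) ≤
      ((s + (min m J : ℕ) * h) ^ 2 / 2 - (s + (min m J : ℕ) * h) *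
        Real.log (s + (min m J : ℕ) * h)) - (s ^ 2 / 2 - s * Real.log s) +
        h * (s - 1 - Real.log s) + m * (h ^ 2 / 2 + h ^ 3 / s) := by
    intro m
    induction m with
    | zero => simp
    | succ m ih =>
      rw [Finset.sum_range_succ]
      have hh3 : 0 ≤ h ^ 3 / s := by positivity
      by_cases hm : m < J
      · rw [min_eq_left (show m ≤ J by omega)] at ih
        rw [min_eq_left (show m + 1 ≤ J by omega)]
        rw [Nat.cast_succ]
        set x := s + m * h with hx
        have hxpos : 0 < x := by positivity
        have hy : s + ((m : ℝ) + 1) * h = x + h := by rw [hx]; ring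
        rw [hy]
        have hlog : x * (Real.log (x + h) - Real.log x) ≤ h := by
          rw [← Real.log_div (by positivity) hxpos.ne']
          have := Real.log_le_sub_one_of_pos (x := (x + h) / x) (by positivity)
          calc x * Real.log ((x + h) / x) ≤ x * ((x + h) / x - 1) := by gcongr
            _ = h := by field_simp; ring
        nlinarith
      · rw [min_eq_right (show J ≤ m by omega)] at ih
        rw [min_eq_right (show J ≤ m + 1 by omega)]
        rw [Nat.cast_succ]
        set x := s + J * h with hx
        have hJh : 0 ≤ J * h := by positivity
        have hsx : s ≤ x := by linarith
        have hxpos : 0 < x := hs.trans_le hsx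
        have hrate : x - 1 - Real.log x ≤ h ^ 2 / s := by
          have h1 := Real.one_sub_inv_le_log_of_pos hxpos
          have h2 : x - 1 - (1 - x⁻¹) = (1 - x) ^ 2 / x := by field_simp; ring
          have h3 : (1 - x) ^ 2 / x ≤ h ^ 2 / s := by
            have : 1 - x ≤ h := by rw [hx]; linarith
            have : 0 ≤ 1 - x := by linarith
            gcongr
          linarith
        have h4 : h * (x - 1 - Real.log x) ≤ h ^ 3 / s := by
          calc h * (x - 1 - Real.log x) ≤ h * (h ^ 2 / s) := by gcongr
            _ = h ^ 3 / s := by ring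
        nlinarith [sq_nonneg h]
  refine (main k).trans ?_
  rw [min_eq_right hk]
  set x := s + J * h with hx
  have hxpos : 0 < x := by positivity
  have h1 := Real.one_sub_inv_le_log_of_pos hxpos
  have h2 : x - 1 ≤ x * Real.log x := by
    calc x - 1 = x * (1 - x⁻¹) := by field_simp
      _ ≤ _ := by gcongr
  have h3 : (1 - x) ^ 2 ≤ h ^ 2 := by
    have : 1 - x ≤ h := by rw [hx]; linarith
    have : 0 ≤ 1 - x := by linarith
    gcongr
  nlinarith

end Estimates

section Asymptotics

lemma exists_pos_mul_log_le (K κ : ℝ) (hκ : 0 < κ) :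
    ∃ b : ℕ, 0 < b ∧ K * Real.log (16 * b) / b ≤ κ := by
  have h1 : Tendsto (fun b : ℕ => K * 16 * (Real.log (16 * (b : ℝ)) ^ 1 / (1 * (16 * (b : ℝ)) + 0)))
      atTop (nhds (K * 16 * 0)) :=
    ((Real.tendsto_pow_log_div_mul_add_atTop 1 0 1 one_ne_zero).comp
      (tendsto_natCast_atTop_atTop.const_mul_atTop (by norm_num : (0 : ℝ) < 16))).const_mul _
  rw [mul_zero] at h1
  obtain ⟨b, hb, hb0⟩ := ((h1.eventually_lt_const hκ).and (eventually_gt_atTop 0)).exists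
  refine ⟨b, hb0, le_trans (le_of_eq ?_) hb.le⟩
  field_simp
  simp
  ring

lemma eventually_mul_log_add_le (A B : ℝ) :
    ∀ᶠ n : ℕ in atTop, A * Real.log n + B ≤ n / 2 := by
  have h1 : Tendsto (fun n : ℕ => A * (Real.log (n : ℝ) ^ 1 / (1 * (n : ℝ) + 0)))
      atTop (nhds (A * 0)) :=
    ((Real.tendsto_pow_log_div_mul_add_atTop 1 0 1 one_ne_zero).comp
      tendsto_natCast_atTop_atTop).const_mul _
  have h2 := tendsto_const_div_atTop_nhds_zero_nat B
  have h3 := h1.add h2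
  rw [mul_zero, add_zero] at h3
  filter_upwards [h3.eventually_le_const (by norm_num : (0 : ℝ) < 1 / 2), eventually_gt_atTop 0]
    with n hn hn0
  have hn0 : (0 : ℝ) < n := by exact_mod_cast hn0
  have : A * (Real.log (n : ℝ) ^ 1 / (1 * (n : ℝ) + 0)) + B / n = (A * Real.log n + B) / n := by
    simp; ring
  rw [this, div_le_iff₀ hn0] at hn
  linarith

/-- Lower bound for the product of the layer contributions up to size of order `log n`. -/
lemma exp_neg_le_prod_stepBound {ε r K : ℝ} (hε0 : 0 < ε) (hε1 : ε < 1) (hr : 0 < r)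
    (hK : ε / r ≤ K) {b : ℕ} (hb : 0 < b) {κ : ℝ} (hκ : K * Real.log (16 * b) / b ≤ κ) :
    ∃ C : ℝ, ∀ᶠ n : ℕ in atTop, ∃ J : ℕ,
      Real.exp (-(Real.log n * (-Ier ε r + κ) + C)) ≤
        ∏ j ∈ Finset.range (⌈K * Real.log n / b⌉₊ + 1),
          stepBound n b ((1 - ε) / n) (r / (n * Real.log n)) (1 + b + j * b) (min j J * b) b := by
  set s := 1 - ε with hs
  have hs0 : 0 < s := by linarith
  have hb0 : (0 : ℝ) < b := by exact_mod_cast hb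
  have hb1 : (1 : ℝ) ≤ b := by exact_mod_cast hb
  have hK0 : 0 ≤ K := le_trans (by positivity) hK
  have hlog16 : 0 ≤ Real.log (16 * b) := Real.log_nonneg (by linarith)
  refine ⟨r * b ^ 2 / 2 + b * (s - 1 - Real.log s) + (K + b) * (r * b / 2 + (r * b) ^ 2 / s) +
    2 * Real.log (16 * b), ?_⟩
  have hlogtop : Tendsto (fun n : ℕ => Real.log n) atTop atTop :=
    Real.tendsto_log_atTop.comp tendsto_natCast_atTop_atTop
  filter_upwards [eventually_ge_atTop 2, hlogtop.eventually_ge_atTop 1,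
    hlogtop.eventually_ge_atTop r, hlogtop.eventually_ge_atTop (r * b ^ 2),
    eventually_mul_log_add_le ((b + 2) * K) ((b + 2) * (4 * b + 2))] with n hn hL1 hLr hLb hsmall
  set L := Real.log n with hL
  have hL0 : 0 < L := by linarith
  set h : ℝ := r * b / L with hh
  have hh0 : 0 < h := by positivity
  set J : ℕ := ⌊ε * L / (r * b)⌋₊ with hJdef
  set k : ℕ := ⌈K * L / b⌉₊ with hkdef
  have hJ1 : (J : ℝ) * h ≤ ε := by
    have := Nat.floor_le (a := ε * L / (r * b)) (by positivity)
    rw [← hJdef, le_div_iff₀ (by positivity)] at this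
    rw [hh, ← mul_div_assoc, div_le_iff₀ hL0]
    exact this
  have hJ2 : ε ≤ (J + 1) * h := by
    have := (Nat.lt_floor_add_one (ε * L / (r * b))).le
    rw [← hJdef, div_le_iff₀ (by positivity)] at this
    rw [hh, ← mul_div_assoc, le_div_iff₀ hL0]
    exact this
  have hk1 : (k : ℝ) ≤ K * L / b + 1 := (Nat.ceil_lt_add_one (by positivity)).le
  have hJk : J ≤ k := by
    refine (Nat.floor_mono ?_).trans (Nat.floor_le_ceil _)
    rw [← div_div]
    have : ε * L / r ≤ K * L := by
      rw [mul_div_right_comm]; gcongr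
    gcongr
  have hkb : (k : ℝ) * b ≤ K * L + b := by
    calc (k : ℝ) * b ≤ (K * L / b + 1) * b := by gcongr
      _ = _ := by field_simp
  have hkb' : (k : ℝ) * b ≤ (K + b) * L := by nlinarith
  refine ⟨J, ?_⟩
  set l : ℕ → ℝ := fun j => s + (min j J : ℕ) * h with hldef
  have hstep : ∀ j ∈ Finset.range (k + 1),
      Real.exp (-(b * (l j - 1 - Real.log (l j)) + Real.log (16 * b))) ≤
        stepBound n b (s / n) (r / (n * L)) (1 + b + j * b) (min j J * b) b := by
    intro j hj
    have hjk : (j : ℝ) ≤ k := by exact_mod_cast Nat.lt_succ_iff.1 (Finset.mem_range.1 hj)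
    have hminJ : ((min j J : ℕ) : ℝ) ≤ J := by exact_mod_cast min_le_right _ _
    refine exp_neg_le_stepBound hε0 hε1 hr hb hn hL0 hLr hLb ?_ ?_ ?_
    · show s + ((min j J : ℕ) : ℝ) * h = s + r * ((min j J * b : ℕ) : ℝ) / L
      rw [hh, Nat.cast_mul]
      ring
    · have : ((min j J : ℕ) : ℝ) * h ≤ J * h := by gcongr
      simp only [hldef]; linarith
    · push_cast
      have : (j : ℝ) * b ≤ K * L + b := le_trans (by gcongr) hkb
      calc ((b : ℝ) + 2) * (1 + b + j * b + 2 * b + 1)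
          ≤ (b + 2) * (1 + b + (K * L + b) + 2 * b + 1) := by gcongr
        _ = (b + 2) * K * L + (b + 2) * (4 * b + 2) := by ring
        _ ≤ _ := hsmall
  refine le_trans ?_ (Finset.prod_le_prod (fun _ _ => (Real.exp_pos _).le) hstep)
  rw [← Real.exp_sum, Real.exp_le_exp, Finset.sum_neg_distrib, neg_le_neg_iff,
    Finset.sum_add_distrib, Finset.sum_const, Finset.card_range, nsmul_eq_mul]
  have hsum := sum_rate_le hs0 hh0 J k (by linarith) (by linarith) hJk
  have hbh : (b : ℝ) = L / r * h := by rw [hh]; field_simp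
  have hscale : ∑ j ∈ Finset.range (k + 1), b * (l j - 1 - Real.log (l j)) =
      L / r * ∑ j ∈ Finset.range (k + 1), h * (l j - 1 - Real.log (l j)) := by
    rw [Finset.mul_sum]
    refine Finset.sum_congr rfl fun j _ => ?_
    rw [hbh]; ring
  have hmain : L / r * ∑ j ∈ Finset.range (k + 1), h * (l j - 1 - Real.log (l j)) ≤
      L / r * ((1 - s ^ 2) / 2 + s * Real.log s + h ^ 2 / 2 + h * (s - 1 - Real.log s) +
        k * (h ^ 2 / 2 + h ^ 3 / s)) := by gcongr
  have hexpand : L / r * ((1 - s ^ 2) / 2 + s * Real.log s + h ^ 2 / 2 +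
        h * (s - 1 - Real.log s) + k * (h ^ 2 / 2 + h ^ 3 / s)) =
      L * (-Ier ε r) + r * b ^ 2 / 2 / L + b * (s - 1 - Real.log s) +
        (k * b) * (r * b / 2 / L + (r * b) ^ 2 / s / L / L) := by
    rw [Ier, ← hs, show ε = 1 - s by rw [hs]; ring, hh]
    field_simp
    ring
  have t1 : r * b ^ 2 / 2 / L ≤ r * b ^ 2 / 2 := div_le_self (by positivity) hL1
  have t2 : (k * b : ℝ) * (r * b / 2 / L + (r * b) ^ 2 / s / L / L) ≤
      (K + b) * (r * b / 2 + (r * b) ^ 2 / s) := by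
    calc (k * b : ℝ) * (r * b / 2 / L + (r * b) ^ 2 / s / L / L)
        ≤ ((K + b) * L) * (r * b / 2 / L + (r * b) ^ 2 / s / L / L) := by gcongr
      _ = (K + b) * (r * b / 2 + (r * b) ^ 2 / s / L) := by field_simp
      _ ≤ _ := mul_le_mul_of_nonneg_left
        (add_le_add le_rfl (div_le_self (by positivity) hL1)) (by positivity)
  have t3 : ((k + 1 : ℕ) : ℝ) * Real.log (16 * b) ≤ L * κ + 2 * Real.log (16 * b) := by
    calc ((k + 1 : ℕ) : ℝ) * Real.log (16 * b) ≤ (K * L / b + 2) * Real.log (16 * b) := by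
          gcongr; push_cast; linarith
      _ = L * (K * Real.log (16 * b) / b) + 2 * Real.log (16 * b) := by ring
      _ ≤ _ := by gcongr
  rw [hscale]
  linarith

/-- Lower bound for the contribution of the first layer. -/
lemma le_stepBound_first {ε r : ℝ} (hε0 : 0 < ε) (hε1 : ε < 1) (hr : 0 < r) (b : ℕ) :
    ∀ᶠ n : ℕ in atTop, 1 / 2 * (Real.exp (-(1 - ε)) * ((1 - ε) ^ b / b.factorial)) ≤
      stepBound n b ((1 - ε) / n) (r / (n * Real.log n)) 1 0 1 := by
  have hlogtop : Tendsto (fun n : ℕ => Real.log n) atTop atTop :=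
    Real.tendsto_log_atTop.comp tendsto_natCast_atTop_atTop
  filter_upwards [eventually_ge_atTop 2, hlogtop.eventually_ge_atTop r,
    eventually_mul_log_add_le 0 ((b + 2) * (b + 2))] with n hn hLr hsmall
  have hn0 : (0 : ℝ) < n := by positivity
  have hL0 : 0 < Real.log n := by linarith
  refine poisson_le_stepBound hn ⟨div_nonneg (by linarith) hn0.le, by gcongr; linarith⟩
    ⟨by positivity, ?_⟩ ?_ ?_
  · rw [div_le_div_iff₀ (by positivity) hn0]
    nlinarith
  · simp only [zero_add, Nat.choose_succ_self, Nat.zero_sub]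
    push_cast
    field_simp
    simp
  · refine le_trans (mul_le_mul_of_nonneg_left ?_ (by positivity))
      (by linarith : ((b : ℝ) + 2) * (b + 2) ≤ n / 2)
    push_cast
    linarith

end Asymptotics

/-- If `I_{ε,r} > -1` then the expected number of good vertices exceeds `n^κ`
for some constant `κ > 0` and all sufficiently large `n`. -/
theorem expected_good_count_large (ε r : ℝ) (hε0 : 0 < ε) (hε1 : ε < 1) (hr : 0 < r)
    (hI : -1 < Ier ε r) :
    ∃ κ > (0 : ℝ), ∃ N : ℕ, ∀ n ≥ N,
      ENNReal.ofReal ((n : ℝ) ^ κ) <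
        ∫⁻ ω, (goodCount n ε r ω : ℝ≥0∞) ∂(hypMeasure n ε r) := by
  obtain ⟨κ, hκ, hκI⟩ : ∃ κ : ℝ, 0 < κ ∧ 3 * κ = 1 + Ier ε r :=
    ⟨(1 + Ier ε r) / 3, by linarith, by ring⟩
  have hK : ε / r ≤ K0 ε r := by
    refine le_trans ?_ (le_max_right _ _)
    gcongr
    linarith
  obtain ⟨b, hb, hbκ⟩ := exists_pos_mul_log_le (K0 ε r) κ hκ
  obtain ⟨C, hC⟩ := exp_neg_le_prod_stepBound hε0 hε1 hr hK hb hbκ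
  have hb0 : (0 : ℝ) < b := by exact_mod_cast hb
  set c₀ : ℝ := 1 / 2 * (Real.exp (-(1 - ε)) * ((1 - ε) ^ b / b.factorial)) with hc₀
  have hc₀pos : 0 < c₀ := by
    have : 0 < 1 - ε := by linarith
    positivity
  have hlogtop : Tendsto (fun n : ℕ => Real.log n) atTop atTop :=
    Real.tendsto_log_atTop.comp tendsto_natCast_atTop_atTop
  refine ⟨κ, hκ, eventually_atTop.1 ?_⟩
  filter_upwards [hC, le_stepBound_first hε0 hε1 hr b, eventually_ge_atTop 2,
    hlogtop.eventually_ge_atTop r, (hlogtop.const_mul_atTop hκ).eventually_gt_atTop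
      (C - Real.log c₀)] with n ⟨J, hprod⟩ hfirst hn hLr hlarge
  have hn0 : (0 : ℝ) < n := by positivity
  have hn1 : (1 : ℝ) ≤ n := by exact_mod_cast (by omega : 1 ≤ n)
  have hL0 : 0 < Real.log n := by linarith
  have h₂ : (1 - ε) / n ∈ Set.Icc (0 : ℝ) 1 :=
    ⟨div_nonneg (by linarith) hn0.le, by rw [div_le_one hn0]; linarith⟩
  have h₃ : r / (n * Real.log n) ∈ Set.Icc (0 : ℝ) 1 :=
    ⟨by positivity, by rw [div_le_one (by positivity)]; nlinarith⟩
  have hfin : IsFiniteMeasure (hypMeasure n ε r) := by unfold hypMeasure; infer_instance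
  have hvertex : ∀ v : Fin n, c₀ * Real.exp (-(Real.log n * (-Ier ε r + κ) + C)) ≤
      (hypMeasure n ε r).real
        {ω | K0 ε r * Real.log n ≤ ((propComponent ω {v}).ncard : ℝ)} := by
    intro v
    refine le_trans (mul_le_mul hfirst hprod (Real.exp_pos _).le (hc₀pos.le.trans hfirst)) ?_
    refine le_trans (le_edgeMeasure_real_propComponent h₂ h₃ b J _ hb v) ?_
    refine measureReal_mono (μ := hypMeasure n ε r) fun ω hω => ?_
    have hω' : 1 + (⌈K0 ε r * Real.log n / b⌉₊ + 1 + 1) * b ≤ (propComponent ω {v}).ncard := hω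
    have h1 := Nat.le_ceil (K0 ε r * Real.log n / b)
    rw [div_le_iff₀ hb0] at h1
    have h2 : ((1 + (⌈K0 ε r * Real.log n / b⌉₊ + 1 + 1) * b : ℕ) : ℝ) ≤
        ((propComponent ω {v}).ncard : ℝ) := by exact_mod_cast hω'
    push_cast at h2
    rw [Set.mem_ofPred_eq]
    linarith
  refine lt_of_lt_of_le ?_ (ofReal_mul_le_lintegral_goodCount n ε r _ hvertex)
  have hexp : (n : ℝ) * (c₀ * Real.exp (-(Real.log n * (-Ier ε r + κ) + C))) =
      Real.exp (Real.log n + Real.log c₀ - (Real.log n * (-Ier ε r + κ) + C)) := by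
    rw [sub_eq_add_neg, Real.exp_add, Real.exp_add, Real.exp_log hn0, Real.exp_log hc₀pos]
    ring
  rw [ENNReal.ofReal_lt_ofReal_iff (by positivity), hexp, Real.rpow_def_of_pos hn0,
    Real.exp_lt_exp]
  have hIer : Ier ε r = 3 * κ - 1 := by linarith
  rw [hIer]
  linarith
end

section
/- Assume I_{ε,r} > −1. Let X be the number of good vertices of 𝔾(n,p₂,p₃). Then P(X > 0) tends to 1 as n → ∞; that is, with high probability 𝔾(n,p₂,p₃) contains a good vertex. -/
open MeasureTheory Real Filter

namespace GoodVertex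

/-- `Spread ω S X`: the vertex set `X` is obtained from `S` by successively adding single vertices
`x ∉ X` lying in an edge all of whose other vertices have already been reached. -/
inductive Spread {n : ℕ} (ω : EdgeIdx n → Bool) (S : Finset (Fin n)) : Finset (Fin n) → Prop
  | refl : Spread ω S S
  | step {X e : Finset (Fin n)} {x : Fin n} (h : Spread ω S X) (he : IsEdge ω e) (hx : x ∈ e)
      (hxX : x ∉ X) (hsub : e.erase x ⊆ X) : Spread ω S (insert x X)

namespace Spread

variable {n : ℕ} {ω ω' : EdgeIdx n → Bool} {S X Y : Finset (Fin n)}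

lemma trans (h : Spread ω S X) (h' : Spread ω X Y) : Spread ω S Y := by
  induction h' with
  | refl => exact h
  | step _ he hx hxX hsub ih => exact ih.step he hx hxX hsub

lemma mono (hω : ∀ e, ω e = true → ω' e = true) (h : Spread ω S X) : Spread ω' S X := by
  induction h with
  | refl => exact .refl
  | step _ he hx hxX hsub ih => exact ih.step (he.imp fun h h' => hω _ h') hx hxX hsub

lemma exists_isPropSeqFrom (h : Spread ω S X) :
    ∃ k f, IsPropSeqFrom ω S k f ∧ X = S ∪ (Finset.range k).biUnion f := by
  induction h with
  | refl => exact ⟨0, fun _ => ∅, ⟨by simp, by simp⟩, by simp⟩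
  | @step X e x _ he hx hxX hsub ih =>
    obtain ⟨k, f, ⟨hf₁, hf₂⟩, rfl⟩ := ih
    have hpre : ∀ l ≤ k, (Finset.range l).biUnion (Function.update f k e) =
        (Finset.range l).biUnion f := fun l hl =>
      Finset.biUnion_congr rfl fun i hi => by
        rw [Function.update_of_ne]
        have := Finset.mem_range.1 hi
        omega
    refine ⟨k + 1, Function.update f k e, ⟨fun i hi => ?_, fun l hl => ?_⟩, ?_⟩
    · rcases Nat.lt_succ_iff_lt_or_eq.1 hi with hi | rfl
      · rw [Function.update_of_ne hi.ne]
        exact hf₁ i hi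
      · simpa using he
    · rw [hpre l (by omega)]
      rcases Nat.lt_succ_iff_lt_or_eq.1 hl with hl | rfl
      · rw [Function.update_of_ne hl.ne]
        exact hf₂ l hl
      · rw [Function.update_self, ← Finset.card_erase_of_mem hx]
        congr 1
        ext y
        simp only [Finset.mem_inter, Finset.mem_erase]
        constructor
        · rintro ⟨h1, h2⟩
          exact ⟨fun h => hxX (h ▸ h2), h1⟩
        · rintro ⟨h1, h2⟩
          exact ⟨h2, hsub (Finset.mem_erase.2 ⟨h1, h2⟩)⟩
    · rw [Finset.range_add_one, Finset.biUnion_insert, hpre k le_rfl, Function.update_self]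
      ext y
      have := @hsub y
      simp only [Finset.mem_erase, Finset.mem_insert, Finset.mem_union] at this ⊢
      by_cases hy : y = x
      · subst hy
        simp [hx]
      · tauto

lemma subset_propComponent (h : Spread ω S X) : (X : Set (Fin n)) ⊆ propComponent ω S := by
  obtain ⟨k, f, hf, rfl⟩ := h.exists_isPropSeqFrom
  intro x hx
  simp only [Finset.coe_union, Set.mem_union, Finset.mem_coe, Finset.mem_biUnion,
    Finset.mem_range] at hx
  rcases hx with hx | ⟨i, hi, hx⟩
  · exact Or.inl hx
  · exact Or.inr ⟨k, f, hf, i, hi, hx⟩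

lemma union_of_forall {N : Finset (Fin n)}
    (h : ∀ w ∈ N, ∃ e, IsEdge ω e ∧ w ∈ e ∧ e.erase w ⊆ S) : Spread ω S (S ∪ N) := by
  induction N using Finset.induction_on with
  | empty => simpa using Spread.refl
  | insert w N _ ih =>
    have ih := ih fun w hw => h w (Finset.mem_insert_of_mem hw)
    rw [Finset.union_insert]
    by_cases hw : w ∈ S ∪ N
    · rwa [Finset.insert_eq_of_mem hw]
    · obtain ⟨e, he, hwe, hsub⟩ := h w (Finset.mem_insert_self _ _)
      exact ih.step he hwe hw (hsub.trans Finset.subset_union_left)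

end Spread

/-- Propagation from `S` reaches at least `m` vertices. -/
def Large {n : ℕ} (m : ℕ) (ω : EdgeIdx n → Bool) (S : Finset (Fin n)) : Prop :=
  ∃ X, Spread ω S X ∧ m ≤ X.card

lemma Large.mono {n m : ℕ} {ω ω' : EdgeIdx n → Bool} {S : Finset (Fin n)}
    (hω : ∀ e, ω e = true → ω' e = true) (h : Large m ω S) : Large m ω' S :=
  let ⟨X, hX, hm⟩ := h
  ⟨X, hX.mono hω, hm⟩

lemma Large.goodCount_pos {n m : ℕ} {ε r : ℝ} {ω : EdgeIdx n → Bool} {v : Fin n}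
    (h : Large m ω {v}) (hm : K0 ε r * Real.log n ≤ m) : 0 < goodCount n ε r ω := by
  obtain ⟨X, hX, hmX⟩ := h
  refine (Set.ncard_pos (Set.toFinite _)).2 ⟨v, hm.trans ?_⟩
  have := Set.ncard_le_ncard hX.subset_propComponent (Set.toFinite _)
  rw [Set.ncard_coe_finset] at this
  exact_mod_cast hmX.trans this

/-- The configuration `ω` with all edges outside `F` removed. -/
noncomputable def keep {n : ℕ} (F : Set (EdgeIdx n)) (ω : EdgeIdx n → Bool) : EdgeIdx n → Bool :=
  open Classical in fun e => if e ∈ F then ω e else false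

lemma keep_eq_true {n : ℕ} {F : Set (EdgeIdx n)} {ω : EdgeIdx n → Bool} {e : EdgeIdx n} :
    keep F ω e = true ↔ e ∈ F ∧ ω e = true := by
  simp [keep]

lemma keep_congr {n : ℕ} {F : Set (EdgeIdx n)} {ω ω' : EdgeIdx n → Bool}
    (h : ∀ e ∈ F, ω e = ω' e) : keep F ω = keep F ω' := by
  ext e
  rw [keep, keep]
  split_ifs with he
  exacts [h e he, rfl]

/-- Law of the random hypergraph with arbitrary edge probabilities `p₂` and `p₃`. -/
noncomputable def edgeLaw (n : ℕ) (p₂ p₃ : ℝ) : Measure (EdgeIdx n → Bool) :=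
  Measure.pi fun e => bern (if e.1.card = 2 then p₂ else p₃)

lemma isProbabilityMeasure_bern {p : ℝ} (h0 : 0 ≤ p) (h1 : p ≤ 1) :
    IsProbabilityMeasure (bern p) := by
  constructor
  simp [bern, ← ENNReal.ofReal_add h0 (sub_nonneg.2 h1)]

lemma isProbabilityMeasure_edgeLaw {n : ℕ} {p₂ p₃ : ℝ} (h2 : p₂ ∈ Set.Icc (0 : ℝ) 1)
    (h3 : p₃ ∈ Set.Icc (0 : ℝ) 1) : IsProbabilityMeasure (edgeLaw n p₂ p₃) := by
  have : ∀ e : EdgeIdx n, IsProbabilityMeasure (bern (if e.1.card = 2 then p₂ else p₃)) := by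
    intro e
    split_ifs
    exacts [isProbabilityMeasure_bern h2.1 h2.2, isProbabilityMeasure_bern h3.1 h3.2]
  unfold edgeLaw
  infer_instance

/-- The event `E` only depends on the edges in `F`. -/
def DeterminedBy {n : ℕ} (E : Set (EdgeIdx n → Bool)) (F : Set (EdgeIdx n)) : Prop :=
  DependsOn (· ∈ E) F

lemma DeterminedBy.mono {n : ℕ} {E : Set (EdgeIdx n → Bool)} {F G : Set (EdgeIdx n)}
    (h : DeterminedBy E F) (hFG : F ⊆ G) : DeterminedBy E G :=
  fun _ _ hxy => h fun i hi => hxy i (hFG hi)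

lemma DeterminedBy.compl {n : ℕ} {E : Set (EdgeIdx n → Bool)} {F : Set (EdgeIdx n)}
    (h : DeterminedBy E F) : DeterminedBy Eᶜ F :=
  fun _ _ hxy => congrArg Not (h hxy)

lemma determinedBy_iInter {n : ℕ} {ι : Type*} {s : Finset ι} {E : ι → Set (EdgeIdx n → Bool)}
    {F : ι → Set (EdgeIdx n)} (h : ∀ i ∈ s, DeterminedBy (E i) (F i)) :
    DeterminedBy (⋂ i ∈ s, E i) (⋃ i ∈ s, F i) := by
  intro x y hxy
  simp only [Set.mem_iInter, eq_iff_iff]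
  refine forall₂_congr fun i hi => eq_iff_iff.1 (h i hi fun e he => hxy e ?_)
  exact Set.mem_biUnion (Finset.mem_coe.2 hi) he

lemma measureReal_inter_eq_mul {n : ℕ} {p₂ p₃ : ℝ} (h2 : p₂ ∈ Set.Icc (0 : ℝ) 1)
    (h3 : p₃ ∈ Set.Icc (0 : ℝ) 1) {E E' : Set (EdgeIdx n → Bool)} {F F' : Set (EdgeIdx n)}
    (hE : DeterminedBy E F) (hE' : DeterminedBy E' F') (hF : Disjoint F F') :
    (edgeLaw n p₂ p₃).real (E ∩ E') = (edgeLaw n p₂ p₃).real E * (edgeLaw n p₂ p₃).real E' := by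
  classical
  have : ∀ e : EdgeIdx n, IsProbabilityMeasure (bern (if e.1.card = 2 then p₂ else p₃)) := by
    intro e
    split_ifs
    exacts [isProbabilityMeasure_bern h2.1 h2.2, isProbabilityMeasure_bern h3.1 h3.2]
  have hind := ProbabilityTheory.iIndepFun_pi
    (μ := fun e : EdgeIdx n => bern (if e.1.card = 2 then p₂ else p₃))
    (X := fun _ => id) (fun _ => measurable_id.aemeasurable)
  have hind' := hind.indepFun_finset F.toFinset F'.toFinset (Set.disjoint_toFinset.2 hF)
    fun i => measurable_pi_apply i
  have key : ∀ {E : Set (EdgeIdx n → Bool)} {F : Set (EdgeIdx n)}, DeterminedBy E F →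
      (fun (a : EdgeIdx n → Bool) (i : F.toFinset) => id (a i)) ⁻¹'
        ((fun (a : EdgeIdx n → Bool) (i : F.toFinset) => id (a i)) '' E) = E := by
    intro E F hE
    refine Set.Subset.antisymm ?_ (Set.subset_preimage_image _ _)
    rintro x ⟨y, hy, hxy⟩
    have h := hE (x := y) (y := x) fun e he => congrFun hxy ⟨e, by simpa using he⟩
    exact h.mp hy
  have := hind'.measure_inter_preimage_eq_mul
    ((fun (a : EdgeIdx n → Bool) (i : F.toFinset) => id (a i)) '' E)
    ((fun (a : EdgeIdx n → Bool) (i : F'.toFinset) => id (a i)) '' E')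
    (Set.toFinite _).measurableSet (Set.toFinite _).measurableSet
  rw [key hE, key hE'] at this
  simp only [measureReal_def, edgeLaw, this, ENNReal.toReal_mul]

lemma measureReal_iInter_eq_prod {n : ℕ} {p₂ p₃ : ℝ} (h2 : p₂ ∈ Set.Icc (0 : ℝ) 1)
    (h3 : p₃ ∈ Set.Icc (0 : ℝ) 1) {ι : Type*} {s : Finset ι} {E : ι → Set (EdgeIdx n → Bool)}
    {F : ι → Set (EdgeIdx n)} (hE : ∀ i ∈ s, DeterminedBy (E i) (F i))
    (hF : (s : Set ι).PairwiseDisjoint F) :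
    (edgeLaw n p₂ p₃).real (⋂ i ∈ s, E i) = ∏ i ∈ s, (edgeLaw n p₂ p₃).real (E i) := by
  classical
  have := isProbabilityMeasure_edgeLaw (n := n) h2 h3
  induction s using Finset.induction_on with
  | empty => simp
  | insert i s hi ih =>
    rw [Finset.prod_insert hi, Finset.set_biInter_insert,
      measureReal_inter_eq_mul h2 h3 (hE i (Finset.mem_insert_self _ _))
        (determinedBy_iInter fun j hj => hE j (Finset.mem_insert_of_mem hj)),
      ih (fun j hj => hE j (Finset.mem_insert_of_mem hj)) (hF.subset (by simp))]
    rw [Set.disjoint_iUnion₂_right]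
    intro j hj
    exact hF (by simp) (by simp [hj]) (by rintro rfl; exact hi hj)

lemma measureReal_not_isEdge {n : ℕ} {p₂ p₃ : ℝ} (h2 : p₂ ∈ Set.Icc (0 : ℝ) 1)
    (h3 : p₃ ∈ Set.Icc (0 : ℝ) 1) {e : Finset (Fin n)} (he : e.card = 2 ∨ e.card = 3) :
    (edgeLaw n p₂ p₃).real {ω | ¬ IsEdge ω e} = if e.card = 2 then 1 - p₂ else 1 - p₃ := by
  have : ∀ e : EdgeIdx n, IsProbabilityMeasure (bern (if e.1.card = 2 then p₂ else p₃)) := by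
    intro e
    split_ifs
    exacts [isProbabilityMeasure_bern h2.1 h2.2, isProbabilityMeasure_bern h3.1 h3.2]
  have hset : {ω : EdgeIdx n → Bool | ¬ IsEdge ω e} = Function.eval ⟨e, he⟩ ⁻¹' ({false} : Set Bool) := by
    ext ω
    simp [IsEdge, he]
  rw [hset, edgeLaw, measureReal_def, (measurePreserving_eval
    (fun e : EdgeIdx n => bern (if e.1.card = 2 then p₂ else p₃)) ⟨e, he⟩).measure_preimage
      (MeasurableSet.nullMeasurableSet (Set.toFinite _).measurableSet)]
  split_ifs with h
  · simp [bern, h2.2]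
  · simp [bern, h3.2]

/-- The potential edges joining `w` to `A ∪ B` which contain a vertex of `A` and, if they have three
vertices, also a vertex of `B`. -/
def links {n : ℕ} (A B : Finset (Fin n)) (w : Fin n) : Finset (Finset (Fin n)) :=
  A.image (fun a => {a, w}) ∪ (A ×ˢ B).image fun x => {x.1, x.2, w}

/-- The vertices of `U` joined to `A ∪ B` by an edge in `links A B`. -/
noncomputable def nbr {n : ℕ} (A B U : Finset (Fin n)) (ω : EdgeIdx n → Bool) :
    Finset (Fin n) :=
  open Classical in U.filter fun w => ∃ e ∈ links A B w, IsEdge ω e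

lemma mem_nbr {n : ℕ} {A B U : Finset (Fin n)} {ω : EdgeIdx n → Bool} {w : Fin n} :
    w ∈ nbr A B U ω ↔ w ∈ U ∧ ∃ e ∈ links A B w, IsEdge ω e := by
  simp [nbr]

lemma nbr_subset {n : ℕ} (A B U : Finset (Fin n)) (ω : EdgeIdx n → Bool) : nbr A B U ω ⊆ U :=
  fun _ hw => (mem_nbr.1 hw).1

section links

variable {n : ℕ} {A B : Finset (Fin n)} {w : Fin n} {e : Finset (Fin n)}

lemma mem_links : e ∈ links A B w ↔
    (∃ a ∈ A, e = {a, w}) ∨ ∃ a ∈ A, ∃ b ∈ B, e = {a, b, w} := by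
  simp only [links, Finset.mem_union, Finset.mem_image, Finset.mem_product, Prod.exists, eq_comm]
  refine or_congr Iff.rfl ⟨?_, ?_⟩
  · rintro ⟨a, b, ⟨ha, hb⟩, h⟩
    exact ⟨a, ha, b, hb, h⟩
  · rintro ⟨a, ha, b, hb, h⟩
    exact ⟨a, b, ⟨ha, hb⟩, h⟩

lemma mem_of_mem_links (h : e ∈ links A B w) : w ∈ e := by
  rcases mem_links.1 h with ⟨a, _, rfl⟩ | ⟨a, _, b, _, rfl⟩ <;> simp

lemma exists_mem_of_mem_links (h : e ∈ links A B w) : ∃ a ∈ A, a ∈ e := by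
  rcases mem_links.1 h with ⟨a, ha, rfl⟩ | ⟨a, ha, b, _, rfl⟩ <;> exact ⟨a, ha, by simp⟩

lemma subset_of_mem_links (h : e ∈ links A B w) : e ⊆ insert w (A ∪ B) := by
  rcases mem_links.1 h with ⟨a, ha, rfl⟩ | ⟨a, ha, b, hb, rfl⟩ <;>
    simp [Finset.insert_subset_iff, *]

lemma pair_card (hA : w ∉ A) {a : Fin n} (ha : a ∈ A) : ({a, w} : Finset (Fin n)).card = 2 :=
  Finset.card_pair fun h => hA (h ▸ ha)

lemma triple_card (hAB : Disjoint A B) (hA : w ∉ A) (hB : w ∉ B) {a b : Fin n} (ha : a ∈ A)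
    (hb : b ∈ B) : ({a, b, w} : Finset (Fin n)).card = 3 :=
  Finset.card_eq_three.2 ⟨a, b, w, fun h => Finset.disjoint_left.1 hAB ha (h ▸ hb),
    fun h => hA (h ▸ ha), fun h => hB (h ▸ hb), rfl⟩

lemma measureReal_no_link {p₂ p₃ : ℝ} (h2 : p₂ ∈ Set.Icc (0 : ℝ) 1)
    (h3 : p₃ ∈ Set.Icc (0 : ℝ) 1) (hAB : Disjoint A B) (hA : w ∉ A) (hB : w ∉ B) :
    (edgeLaw n p₂ p₃).real {ω | ∃ e ∈ links A B w, IsEdge ω e}ᶜ =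
      (1 - p₂) ^ A.card * (1 - p₃) ^ (A.card * B.card) := by
  have hset : {ω | ∃ e ∈ links A B w, IsEdge ω e}ᶜ =
      ⋂ e ∈ links A B w, {ω : EdgeIdx n → Bool | ¬ IsEdge ω e} := by
    ext ω
    simp
  have hcard : ∀ e ∈ links A B w, e.card = 2 ∨ e.card = 3 := by
    intro e he
    rcases mem_links.1 he with ⟨a, ha, rfl⟩ | ⟨a, ha, b, hb, rfl⟩
    exacts [Or.inl (pair_card hA ha), Or.inr (triple_card hAB hA hB ha hb)]
  rw [hset, measureReal_iInter_eq_prod h2 h3 (F := fun e => {e' | e'.1 = e}),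
    Finset.prod_congr rfl fun e he => measureReal_not_isEdge h2 h3 (hcard e he), links,
    Finset.prod_union, Finset.prod_image, Finset.prod_image,
    Finset.prod_congr rfl fun a ha => if_pos (pair_card hA ha),
    Finset.prod_congr rfl fun x hx => if_neg ?_]
  · simp
  · rw [triple_card hAB hA hB (Finset.mem_product.1 hx).1 (Finset.mem_product.1 hx).2]
    norm_num
  · rintro ⟨a, b⟩ hx ⟨a', b'⟩ hx' h
    simp only [Finset.coe_product, Set.mem_prod, Finset.mem_coe] at hx hx'
    have hd := Finset.disjoint_left.1 hAB
    dsimp only at h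
    have h1 : a ∈ ({a', b', w} : Finset (Fin n)) := by rw [← h]; simp
    have h2 : b ∈ ({a', b', w} : Finset (Fin n)) := by rw [← h]; simp
    simp only [Finset.mem_insert, Finset.mem_singleton] at h1 h2
    ext1 <;> dsimp only
    · rcases h1 with rfl | rfl | rfl
      exacts [rfl, absurd hx'.2 (hd hx.1), absurd hx.1 hA]
    · rcases h2 with rfl | rfl | rfl
      exacts [absurd hx.2 (hd hx'.1), rfl, absurd hx.2 hB]
  · intro a ha a' ha' h
    dsimp only at h
    have h1 : a ∈ ({a', w} : Finset (Fin n)) := by rw [← h]; simp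
    simp only [Finset.mem_insert, Finset.mem_singleton] at h1
    rcases h1 with rfl | rfl
    exacts [rfl, absurd ha hA]
  · rw [Finset.disjoint_left]
    intro e he he'
    obtain ⟨a, ha, rfl⟩ := Finset.mem_image.1 he
    obtain ⟨x, hx, h⟩ := Finset.mem_image.1 he'
    have h1 := triple_card hAB hA hB (Finset.mem_product.1 hx).1 (Finset.mem_product.1 hx).2
    rw [h, pair_card hA ha] at h1
    omega
  · intro e _ ω ω' h
    refine congrArg Not ?_
    simp only [IsEdge, eq_iff_iff]
    exact exists_congr fun he => by rw [h _ rfl]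
  · intro e _ e' _ hne
    exact Set.disjoint_left.2 fun x hx hx' => hne (hx.symm.trans hx')

end links

lemma determinedBy_exists_link {n : ℕ} (A B : Finset (Fin n)) (w : Fin n) :
    DeterminedBy {ω | ∃ e ∈ links A B w, IsEdge ω e} {e | e.1 ∈ links A B w} := by
  intro ω ω' h
  simp only [Set.mem_ofPred_eq, IsEdge, eq_iff_iff]
  refine exists_congr fun e => and_congr_right fun he => exists_congr fun hc => ?_
  rw [h ⟨e, hc⟩ he]

lemma determinedBy_nbr_eq {n : ℕ} (A B U W : Finset (Fin n)) :
    DeterminedBy {ω | nbr A B U ω = W} {e | ∃ w ∈ U, e.1 ∈ links A B w} := by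
  intro ω ω' h
  have : nbr A B U ω = nbr A B U ω' := by
    ext w
    rw [mem_nbr, mem_nbr]
    exact and_congr_right fun hw =>
      eq_iff_iff.1 (determinedBy_exists_link A B w fun e he => h e ⟨w, hw, he⟩)
  simp [this]

lemma measureReal_nbr_eq {n : ℕ} {p₂ p₃ : ℝ} (h2 : p₂ ∈ Set.Icc (0 : ℝ) 1)
    (h3 : p₃ ∈ Set.Icc (0 : ℝ) 1) {A B U W : Finset (Fin n)} (hAB : Disjoint A B)
    (hAU : Disjoint A U) (hBU : Disjoint B U) (hW : W ⊆ U) {x : ℝ}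
    (hx : x = (1 - p₂) ^ A.card * (1 - p₃) ^ (A.card * B.card)) :
    (edgeLaw n p₂ p₃).real {ω | nbr A B U ω = W} =
      (1 - x) ^ W.card * x ^ (U.card - W.card) := by
  classical
  have := isProbabilityMeasure_edgeLaw (n := n) h2 h3
  set E : Fin n → Set (EdgeIdx n → Bool) := fun w => {ω | ∃ e ∈ links A B w, IsEdge ω e}
    with hEdef
  have hE : ∀ w ∈ U, (edgeLaw n p₂ p₃).real (E w)ᶜ = x := fun w hw => by
    rw [hx]
    exact measureReal_no_link h2 h3 hAB (Finset.disjoint_right.1 hAU hw)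
      (Finset.disjoint_right.1 hBU hw)
  have hset : {ω | nbr A B U ω = W} = ⋂ w ∈ U, if w ∈ W then E w else (E w)ᶜ := by
    ext ω
    simp only [Set.mem_ofPred_eq, Set.mem_iInter, Finset.ext_iff, mem_nbr]
    refine forall_congr' fun w => ?_
    by_cases hw : w ∈ W
    · simp [hw, hW hw, hEdef]
    · simp [hw, hEdef]
  rw [hset, measureReal_iInter_eq_prod h2 h3 (F := fun w => {e | e.1 ∈ links A B w})]
  · rw [Finset.prod_congr rfl (g := fun w => if w ∈ W then 1 - x else x), Finset.prod_ite]
    · simp only [Finset.prod_const]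
      rw [Finset.filter_mem_eq_inter, Finset.inter_eq_right.2 hW, Finset.filter_notMem_eq_sdiff,
        Finset.card_sdiff_of_subset hW]
    · intro w hw
      split_ifs
      · rw [← hE w hw, probReal_compl_eq_one_sub (Set.toFinite _).measurableSet]
        ring
      · exact hE w hw
  · intro w _
    split_ifs
    exacts [determinedBy_exists_link A B w, (determinedBy_exists_link A B w).compl]
  · intro w hw w' hw' hne
    refine Set.disjoint_left.2 fun e he he' => ?_
    have h1 := subset_of_mem_links he' (mem_of_mem_links he)
    simp only [Finset.mem_insert, Finset.mem_union] at h1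
    rcases h1 with h1 | h1 | h1
    exacts [hne h1, Finset.disjoint_left.1 hAU h1 hw, Finset.disjoint_left.1 hBU h1 hw]

lemma le_measureReal_card_nbr {n : ℕ} {p₂ p₃ : ℝ} (h2 : p₂ ∈ Set.Icc (0 : ℝ) 1)
    (h3 : p₃ ∈ Set.Icc (0 : ℝ) 1) {A B U : Finset (Fin n)} (hAB : Disjoint A B)
    (hAU : Disjoint A U) (hBU : Disjoint B U) (M : ℕ) {x : ℝ}
    (hx : x = (1 - p₂) ^ A.card * (1 - p₃) ^ (A.card * B.card)) :
    U.card.choose M * ((1 - x) ^ M * x ^ (U.card - M)) ≤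
      (edgeLaw n p₂ p₃).real {ω | M ≤ (nbr A B U ω).card} := by
  have := isProbabilityMeasure_edgeLaw (n := n) h2 h3
  calc
    _ = ∑ W ∈ U.powersetCard M, (edgeLaw n p₂ p₃).real {ω | nbr A B U ω = W} := by
      rw [Finset.sum_congr rfl fun W hW => ?_, Finset.sum_const, Finset.card_powersetCard,
        nsmul_eq_mul]
      rw [measureReal_nbr_eq h2 h3 hAB hAU hBU (Finset.mem_powersetCard.1 hW).1 hx,
        (Finset.mem_powersetCard.1 hW).2]
    _ = (edgeLaw n p₂ p₃).real (⋃ W ∈ U.powersetCard M, {ω | nbr A B U ω = W}) := by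
      rw [measureReal_biUnion_finset]
      · intro W _ W' _ hne
        exact Set.disjoint_left.2 fun ω h h' => hne (h.symm.trans h')
      · exact fun W _ => (Set.toFinite _).measurableSet
    _ ≤ _ := by
      refine measureReal_mono ?_
      intro ω hω
      obtain ⟨W, hW, h⟩ := Set.mem_iUnion₂.1 hω
      simp only [Set.mem_ofPred_eq] at h ⊢
      rw [h, (Finset.mem_powersetCard.1 hW).2]

/-- The edges inside `A ∪ B ∪ U` with at most one vertex outside `A ∪ U`. -/
def liveEdges {n : ℕ} (A B U : Finset (Fin n)) : Set (EdgeIdx n) :=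
  {e | e.1 ⊆ A ∪ B ∪ U ∧ 2 ≤ (e.1 ∩ (A ∪ U)).card}

/-- No vertex of `U` reaches `m` vertices through edges inside `U`. -/
def barren {n : ℕ} (m : ℕ) (U : Finset (Fin n)) : Set (EdgeIdx n → Bool) :=
  {ω | ∀ v ∈ U, ¬ Large m (keep {e | e.1 ⊆ U} ω) {v}}

/-- Neither `S`, through `liveEdges A B U`, nor any vertex of `U`, through edges inside `U`, reaches
`m` vertices. -/
def stuck {n : ℕ} (m : ℕ) (S A B U : Finset (Fin n)) : Set (EdgeIdx n → Bool) :=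
  {ω | ¬ Large m (keep (liveEdges A B U) ω) S} ∩ barren m U

section Exploration

variable {n m : ℕ} {S A A' B B' U U' : Finset (Fin n)}

lemma barren_anti (h : U' ⊆ U) : barren m U ⊆ barren m U' := by
  intro ω hω v hv hL
  refine hω v (h hv) (hL.mono fun e he => ?_)
  rw [keep_eq_true] at he ⊢
  exact ⟨he.1.trans h, he.2⟩

lemma determinedBy_barren (m : ℕ) (U : Finset (Fin n)) :
    DeterminedBy (barren m U) {e | 2 ≤ (e.1 ∩ U).card} := by
  have : DeterminedBy (barren m U) {e | e.1 ⊆ U} := by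
    intro ω ω' h
    simp only [barren, Set.mem_ofPred_eq, keep_congr h]
  refine this.mono fun e he => ?_
  simp only [Set.mem_ofPred_eq] at he ⊢
  rw [Finset.inter_eq_left.2 he]
  have := e.2
  omega

lemma determinedBy_stuck (m : ℕ) (S B : Finset (Fin n)) (h : A ∪ U' ⊆ U) :
    DeterminedBy (stuck m S A B U') {e | 2 ≤ (e.1 ∩ U).card} := by
  intro ω ω' h'
  have h1 : keep (liveEdges A B U') ω = keep (liveEdges A B U') ω' :=
    keep_congr fun e he => h' e (he.2.trans (Finset.card_le_card (by gcongr)))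
  have h2 := determinedBy_barren m U' (x := ω) (y := ω') fun e he =>
    h' e (le_trans he (Finset.card_le_card
      (Finset.inter_subset_inter_left (Finset.subset_union_right.trans h))))
  have h2 : ω ∈ barren m U' ↔ ω' ∈ barren m U' := eq_iff_iff.1 h2
  simp only [stuck, Set.mem_inter_iff, Set.mem_ofPred_eq, h1, h2]

lemma barren_subset_stuck {v : Fin n} (hv : v ∈ U) :
    barren m U ⊆ stuck m {v} {v} ∅ (U.erase v) := by
  refine fun ω hω => ⟨fun hL => hω v hv (hL.mono fun e he => ?_),
    barren_anti (Finset.erase_subset _ _) hω⟩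
  rw [keep_eq_true] at he ⊢
  refine ⟨he.1.1.trans ?_, he.2⟩
  intro x
  simp only [Finset.union_empty, Finset.mem_union, Finset.mem_singleton, Finset.mem_erase]
  rintro (rfl | h)
  exacts [hv, h.2]

lemma stuck_subset_of_subset_nbr {ω : EdgeIdx n → Bool} (hS : A ∪ B ⊆ S) (hAU : Disjoint A U)
    (hB' : B' ⊆ A ∪ B) (hA' : A' ⊆ nbr A B U ω) (hω : ω ∈ stuck m S A B U) :
    ω ∈ stuck m (S ∪ A') A' B' (U \ A') := by
  have hA'U : A' ⊆ U := hA'.trans (nbr_subset A B U ω)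
  refine ⟨fun hL => hω.1 ?_, barren_anti Finset.sdiff_subset hω.2⟩
  obtain ⟨X, hX, hmX⟩ := hL
  refine ⟨X, Spread.trans (X := S ∪ A') (Spread.union_of_forall fun w hw => ?_) (hX.mono ?_), hmX⟩
  · obtain ⟨hwU, e, he, hc, hωe⟩ := mem_nbr.1 (hA' hw)
    refine ⟨e, ⟨hc, ?_⟩, mem_of_mem_links he, ?_⟩
    · refine keep_eq_true.2 ⟨⟨(subset_of_mem_links he).trans ?_, ?_⟩, hωe⟩
      · rw [Finset.insert_subset_iff]
        exact ⟨Finset.mem_union_right _ hwU, Finset.subset_union_left⟩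
      · obtain ⟨a, ha, hae⟩ := exists_mem_of_mem_links he
        have hne : a ≠ w := fun h => Finset.disjoint_left.1 hAU ha (h ▸ hwU)
        refine (Finset.card_pair hne).ge.trans (Finset.card_le_card ?_)
        simp [Finset.insert_subset_iff, ha, hae, hwU, mem_of_mem_links he]
    · rw [← Finset.subset_insert_iff]
      exact (subset_of_mem_links he).trans (Finset.insert_subset_insert _ hS)
  · intro e he
    rw [keep_eq_true] at he ⊢
    refine ⟨⟨he.1.1.trans ?_, he.1.2.trans (Finset.card_le_card ?_)⟩, he.2⟩
    · intro x
      have h1 := @hA'U x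
      have h2 := @hB' x
      simp only [Finset.mem_union, Finset.mem_sdiff] at h2 ⊢
      tauto
    · refine Finset.inter_subset_inter_left fun x => ?_
      have h1 := @hA'U x
      simp only [Finset.mem_union, Finset.mem_sdiff]
      tauto

lemma measureReal_stuck_le {p₂ p₃ : ℝ} (h2 : p₂ ∈ Set.Icc (0 : ℝ) 1)
    (h3 : p₃ ∈ Set.Icc (0 : ℝ) 1) {M : ℕ} {φ ψ q : ℝ} (hAU : Disjoint A U)
    (hBU : Disjoint B U) (hS : A ∪ B ⊆ S) (hB' : B' ⊆ A ∪ B) (hψ : ψ ≤ φ)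
    (hφ : (edgeLaw n p₂ p₃).real (barren m U) ≤ φ)
    (hnext : ∀ A' ⊆ U, A'.card = M →
      (edgeLaw n p₂ p₃).real (stuck m (S ∪ A') A' B' (U \ A')) ≤ ψ)
    (hq : q ≤ (edgeLaw n p₂ p₃).real {ω | M ≤ (nbr A B U ω).card}) :
    (edgeLaw n p₂ p₃).real (stuck m S A B U) ≤ φ * (1 - q) + ψ * q := by
  have := isProbabilityMeasure_edgeLaw (n := n) h2 h3
  set μ := edgeLaw n p₂ p₃
  have hdisj : Disjoint {e : EdgeIdx n | 2 ≤ (e.1 ∩ U).card}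
      {e | ∃ w ∈ U, e.1 ∈ links A B w} := by
    refine Set.disjoint_left.2 ?_
    rintro e he ⟨w, hw, hew⟩
    have : e.1 ∩ U ⊆ {w} := by
      intro x hx
      have h1 := subset_of_mem_links hew (Finset.mem_inter.1 hx).1
      have h2 := (Finset.mem_inter.1 hx).2
      simp only [Finset.mem_insert, Finset.mem_union] at h1
      rcases h1 with h1 | h1 | h1
      exacts [Finset.mem_singleton.2 h1, absurd h2 (Finset.disjoint_left.1 hAU h1),
        absurd h2 (Finset.disjoint_left.1 hBU h1)]
    have h1 := Finset.card_le_card this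
    rw [Finset.card_singleton] at h1
    have h2 : 2 ≤ (e.1 ∩ U).card := he
    omega
  have hsum : ∀ E : Set (EdgeIdx n → Bool),
      μ.real E = ∑ W ∈ U.powerset, μ.real (E ∩ {ω | nbr A B U ω = W}) := by
    intro E
    rw [← measureReal_biUnion_finset]
    · congr 1
      ext ω
      simp only [Set.mem_iUnion, Set.mem_inter_iff, Set.mem_ofPred_eq, Finset.mem_powerset,
        exists_prop]
      exact ⟨fun h => ⟨_, nbr_subset A B U ω, h, rfl⟩, fun ⟨_, _, h, _⟩ => h⟩
    · intro W _ W' _ hne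
      exact Set.disjoint_left.2 fun ω h h' => hne (h.2.symm.trans h'.2)
    · exact fun W _ => (Set.toFinite _).measurableSet
  have hle : ∀ W ∈ U.powerset, μ.real (stuck m S A B U ∩ {ω | nbr A B U ω = W}) ≤
      φ * μ.real (Set.univ ∩ {ω | nbr A B U ω = W}) -
        (φ - ψ) * μ.real ({ω | M ≤ (nbr A B U ω).card} ∩ {ω | nbr A B U ω = W}) := by
    intro W hW
    have hdet := determinedBy_nbr_eq A B U W
    by_cases hM : M ≤ W.card
    · obtain ⟨A', hA'W, hA'⟩ := Finset.exists_subset_card_eq hM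
      have hA'U := hA'W.trans (Finset.mem_powerset.1 hW)
      have h1 : {ω | M ≤ (nbr A B U ω).card} ∩ {ω | nbr A B U ω = W} =
          {ω | nbr A B U ω = W} :=
        Set.inter_eq_right.2 fun ω hω => by
          simp only [Set.mem_ofPred_eq] at hω ⊢
          rwa [hω]
      rw [h1, Set.univ_inter]
      calc
        _ ≤ μ.real (stuck m (S ∪ A') A' B' (U \ A') ∩ {ω | nbr A B U ω = W}) := by
          refine measureReal_mono ?_
          rintro ω ⟨hω, hωW⟩
          exact ⟨stuck_subset_of_subset_nbr hS hAU hB' (hωW.symm ▸ hA'W) hω, hωW⟩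
        _ = μ.real (stuck m (S ∪ A') A' B' (U \ A')) * μ.real {ω | nbr A B U ω = W} :=
          measureReal_inter_eq_mul h2 h3
            (determinedBy_stuck m _ _ (Finset.union_subset hA'U Finset.sdiff_subset)) hdet hdisj
        _ ≤ ψ * μ.real {ω | nbr A B U ω = W} := by
          gcongr
          exact hnext A' hA'U hA'
        _ = _ := by ring
    · have h1 : {ω | M ≤ (nbr A B U ω).card} ∩ {ω | nbr A B U ω = W} = ∅ := by
        ext ω
        simp only [Set.mem_inter_iff, Set.mem_ofPred_eq, Set.mem_empty_iff_false, iff_false]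
        rintro ⟨h, rfl⟩
        exact hM h
      rw [h1, Set.univ_inter]
      calc
        _ ≤ μ.real (barren m U ∩ {ω | nbr A B U ω = W}) :=
          measureReal_mono (Set.inter_subset_inter_left _ Set.inter_subset_right)
        _ = μ.real (barren m U) * μ.real {ω | nbr A B U ω = W} :=
          measureReal_inter_eq_mul h2 h3 (determinedBy_barren m U) hdet hdisj
        _ ≤ φ * μ.real {ω | nbr A B U ω = W} := by gcongr
        _ = _ := by simp
  rw [hsum]
  refine (Finset.sum_le_sum hle).trans ?_
  rw [Finset.sum_sub_distrib, ← Finset.mul_sum, ← Finset.mul_sum, ← hsum, ← hsum, probReal_univ]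
  nlinarith [mul_le_mul_of_nonneg_left hq (sub_nonneg.2 hψ)]

/-- Iterated exploration by generations of size `M`, keeping as a bank at most `b` former
generations. -/
lemma measureReal_stuck_le_of_generations {p₂ p₃ : ℝ} (h2 : p₂ ∈ Set.Icc (0 : ℝ) 1)
    (h3 : p₃ ∈ Set.Icc (0 : ℝ) 1) {M b J n₀ : ℕ} {q : ℕ → ℝ} (hq0 : ∀ i, 0 ≤ q i)
    (hq : ∀ i < J, ∀ A B U : Finset (Fin n), Disjoint A B → Disjoint A U → Disjoint B U →
      A.card = M → B.card = min i b * M → n₀ ≤ U.card →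
      q i ≤ (edgeLaw n p₂ p₃).real {ω | M ≤ (nbr A B U ω).card})
    (hm : m ≤ J * M) {φ : ℝ} (hφ0 : 0 ≤ φ) {u : ℕ} (hu : n₀ ≤ u)
    (hφ : ∀ U : Finset (Fin n), u ≤ U.card → (edgeLaw n p₂ p₃).real (barren m U) ≤ φ)
    {j i : ℕ} (hij : i + j = J) (hAB : Disjoint A B) (hSU : Disjoint S U) (hS : A ∪ B ⊆ S)
    (hA : A.card = M) (hB : B.card = min i b * M) (hSi : i * M ≤ S.card)
    (hU : u + j * M ≤ U.card) :
    (edgeLaw n p₂ p₃).real (stuck m S A B U) ≤ φ * (1 - ∏ k ∈ Finset.Ico i J, q k) := by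
  induction j generalizing i S A B U with
  | zero =>
    obtain rfl : i = J := by omega
    have : stuck m S A B U = ∅ := by
      refine Set.eq_empty_of_forall_notMem fun ω hω => hω.1 ⟨S, .refl, hm.trans hSi⟩
    simp [this]
  | succ j ih =>
    have hAU : Disjoint A U := hSU.mono_left (Finset.subset_union_left.trans hS)
    have hBU : Disjoint B U := hSU.mono_left (Finset.subset_union_right.trans hS)
    have hMU : u + j * M + M ≤ U.card := by linarith
    obtain ⟨B', hB', hB'c⟩ : ∃ B' ⊆ A ∪ B, B'.card = min (i + 1) b * M := by
      by_cases hib : i < b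
      · refine ⟨A ∪ B, subset_rfl, ?_⟩
        rw [Finset.card_union_of_disjoint hAB, hA, hB, min_eq_left hib.le, min_eq_left hib]
        ring
      · refine ⟨B, Finset.subset_union_right, ?_⟩
        rw [hB, min_eq_right (by omega), min_eq_right (by omega)]
    have hQ : 0 ≤ ∏ k ∈ Finset.Ico (i + 1) J, q k := Finset.prod_nonneg fun k _ => hq0 k
    refine (measureReal_stuck_le h2 h3 (B' := B') (φ := φ)
      (ψ := φ * (1 - ∏ k ∈ Finset.Ico (i + 1) J, q k)) hAU hBU hS hB' ?_ ?_ ?_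
      (hq i (by omega) A B U hAB hAU hBU hA hB (by omega))).trans ?_
    · nlinarith
    · exact hφ U (by omega)
    · intro A' hA'U hA'
      have hSA' : Disjoint S A' := hSU.mono_right hA'U
      refine ih (by omega) ?_ ?_ ?_ hA' hB'c ?_ ?_
      · exact (hSA'.mono_left (hB'.trans hS)).symm
      · rw [Finset.disjoint_union_left]
        exact ⟨hSU.mono_right Finset.sdiff_subset, Finset.disjoint_sdiff⟩
      · exact Finset.union_subset Finset.subset_union_right
          ((hB'.trans hS).trans Finset.subset_union_left)
      · rw [Finset.card_union_of_disjoint hSA', hA']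
        linarith
      · rw [Finset.card_sdiff_of_subset hA'U]
        omega
    · rw [Finset.prod_eq_prod_Ico_succ_bot (show i < J by omega)]
      exact le_of_eq (by ring)

/-- Each of `T` successive explorations started at fresh vertices succeeds with probability at least
`q₀ * ∏ k ∈ Finset.Ico 0 J, q k`. -/
lemma measureReal_barren_le {p₂ p₃ : ℝ} (h2 : p₂ ∈ Set.Icc (0 : ℝ) 1)
    (h3 : p₃ ∈ Set.Icc (0 : ℝ) 1) {M b J n₀ : ℕ} {q : ℕ → ℝ} {q₀ : ℝ} (hq0 : ∀ i, 0 ≤ q i)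
    (hq : ∀ i < J, ∀ A B U : Finset (Fin n), Disjoint A B → Disjoint A U → Disjoint B U →
      A.card = M → B.card = min i b * M → n₀ ≤ U.card →
      q i ≤ (edgeLaw n p₂ p₃).real {ω | M ≤ (nbr A B U ω).card})
    (hstart : ∀ (v : Fin n) (U : Finset (Fin n)), v ∉ U → n₀ ≤ U.card →
      q₀ ≤ (edgeLaw n p₂ p₃).real {ω | M ≤ (nbr {v} ∅ U ω).card})
    (hle : q₀ * ∏ k ∈ Finset.Ico 0 J, q k ≤ 1)
    (hm : m ≤ J * M) (T : ℕ) (hU : n₀ + T * (1 + M + J * M) ≤ U.card) :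
    (edgeLaw n p₂ p₃).real (barren m U) ≤ (1 - q₀ * ∏ k ∈ Finset.Ico 0 J, q k) ^ T := by
  have := isProbabilityMeasure_edgeLaw (n := n) h2 h3
  induction T generalizing U with
  | zero => simp
  | succ T ih =>
    have hcard : n₀ + T * (1 + M + J * M) + J * M + M + 1 ≤ U.card := by linarith
    obtain ⟨v, hv⟩ : U.Nonempty := Finset.card_pos.1 (by omega)
    have hUv := Finset.card_erase_of_mem hv
    have hvU : v ∉ U.erase v := Finset.notMem_erase v U
    set φ := (1 - q₀ * ∏ k ∈ Finset.Ico 0 J, q k) ^ T with hφdef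
    have hφ0 : 0 ≤ φ := pow_nonneg (sub_nonneg.2 hle) T
    have hQ : 0 ≤ ∏ k ∈ Finset.Ico 0 J, q k := Finset.prod_nonneg fun k _ => hq0 k
    refine (measureReal_mono (barren_subset_stuck hv)).trans
      ((measureReal_stuck_le h2 h3 (B' := ∅) (M := M) (φ := φ) (q := q₀)
        (ψ := φ * (1 - ∏ k ∈ Finset.Ico 0 J, q k)) ?_ ?_ ?_ ?_ ?_ ?_ ?_ ?_).trans ?_)
    · simp
    · simp
    · simp
    · simp
    · nlinarith
    · exact ih (by omega)
    · intro A' hA'U hA'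
      have hvA' : v ∉ A' := fun h => hvU (hA'U h)
      refine measureReal_stuck_le_of_generations h2 h3 hq0 hq hm hφ0
        (u := n₀ + T * (1 + M + J * M)) (by omega) (fun U hU => ih hU) (j := J) (by omega)
        (by simp) ?_ ?_ hA' (by simp) (by simp) ?_
      · rw [Finset.disjoint_union_left]
        exact ⟨by simp, Finset.disjoint_sdiff⟩
      · simp
      · rw [Finset.card_sdiff_of_subset hA'U]
        omega
    · exact hstart v _ hvU (by omega)
    · rw [pow_succ, ← hφdef]
      exact le_of_eq (by ring)

end Exploration

lemma exp_neg_two_mul_le_one_sub {δ : ℝ} (h0 : 0 ≤ δ) (h1 : δ ≤ 1 / 2) :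
    exp (-(2 * δ)) ≤ 1 - δ := by
  rw [← Real.le_log_iff_exp_le (by linarith)]
  refine le_trans ?_ (Real.one_sub_inv_le_log_of_pos (by linarith))
  have : (1 - δ)⁻¹ ≤ 1 + 2 * δ := by
    rw [inv_le_iff_one_le_mul₀ (by linarith)]
    nlinarith
  linarith

lemma exp_neg_one_add_mul_le_one_sub {δ p : ℝ} (hδ : 0 < δ) (h0 : 0 ≤ p) (h1 : p ≤ δ / (1 + δ)) :
    exp (-((1 + δ) * p)) ≤ 1 - p := by
  rw [le_div_iff₀ (by linarith)] at h1
  have hp : 0 < 1 - p := by nlinarith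
  rw [← Real.le_log_iff_exp_le hp]
  refine le_trans ?_ (Real.one_sub_inv_le_log_of_pos hp)
  have : (1 - p)⁻¹ ≤ 1 + (1 + δ) * p := by
    rw [inv_le_iff_one_le_mul₀ hp]
    nlinarith
  linarith

/-- Lower bound for the probability that a binomial variable with parameters `N` and `1 - x` takes
the value `M`. -/
lemma le_choose_mul_pow {n N M a b : ℕ} {p₂ p₃ δ l x : ℝ} (hn : 0 < n) (hδ0 : 0 < δ)
    (hδ1 : δ ≤ 1 / 2) (h20 : 0 ≤ p₂) (h21 : p₂ ≤ δ / (1 + δ)) (h30 : 0 ≤ p₃)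
    (h31 : p₃ ≤ δ / (1 + δ)) (hl : l = n * (p₂ + b * p₃)) (hal : a * l ≤ δ * n) (hN : N ≤ n)
    (hNM : (1 - δ) * n ≤ (N + 1 - M : ℕ)) (hx : x = (1 - p₂) ^ a * (1 - p₃) ^ (a * b)) :
    (a * l * exp (-(4 * δ))) ^ M / M.factorial * exp (-(a * l * (1 + δ))) ≤
      N.choose M * ((1 - x) ^ M * x ^ (N - M)) := by
  have hn' : (0 : ℝ) < n := by exact_mod_cast hn
  have hδ' : δ / (1 + δ) ≤ 1 := by
    rw [div_le_one (by linarith)]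
    linarith
  have hl0 : 0 ≤ l := by rw [hl]; positivity
  set y := a * l / n with hy
  have hyeq : y = a * p₂ + (a * b : ℕ) * p₃ := by
    rw [hy, hl]
    push_cast
    field_simp
  have hy0 : 0 ≤ y := by positivity
  have hyδ : y ≤ δ := by rwa [hy, div_le_iff₀ hn']
  have hx0 : exp (-((1 + δ) * y)) ≤ x := by
    have e : exp (-((1 + δ) * y)) =
        exp (-((1 + δ) * p₂)) ^ a * exp (-((1 + δ) * p₃)) ^ (a * b) := by
      rw [← Real.exp_nat_mul, ← Real.exp_nat_mul, ← Real.exp_add, hyeq]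
      congr 1
      ring
    rw [hx, e]
    have := h21.trans hδ'
    have : 0 ≤ (1 - p₂) ^ a := pow_nonneg (by linarith) a
    gcongr
    · exact exp_neg_one_add_mul_le_one_sub hδ0 h20 h21
    · exact exp_neg_one_add_mul_le_one_sub hδ0 h30 h31
  have hx0' : 0 < x := (exp_pos _).trans_le hx0
  have hxy : x ≤ exp (-y) := by
    have e : exp (-y) = exp (-p₂) ^ a * exp (-p₃) ^ (a * b) := by
      rw [← Real.exp_nat_mul, ← Real.exp_nat_mul, ← Real.exp_add, hyeq]
      congr 1
      ring
    rw [hx, e]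
    have := h31.trans hδ'
    have := h21.trans hδ'
    have : 0 ≤ (1 - p₃) ^ (a * b) := pow_nonneg (by linarith) _
    gcongr
    · exact Real.one_sub_le_exp_neg p₂
    · exact Real.one_sub_le_exp_neg p₃
  have hx1 : x ≤ 1 := hxy.trans (by simpa using hy0)
  have hxM : (1 - δ) * y ≤ 1 - x := by
    have h1 : exp (-y) ≤ 1 - (1 - δ) * y := by
      rw [Real.exp_neg, inv_le_iff_one_le_mul₀ (exp_pos _)]
      have h2 := Real.add_one_le_exp y
      have h3 : (0 : ℝ) ≤ 1 - (1 - δ) * y := by nlinarith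
      nlinarith [mul_le_mul_of_nonneg_left h2 h3, mul_nonneg hy0 (sub_nonneg.2 hyδ),
        mul_nonneg (mul_nonneg hδ0.le hy0) hy0]
    linarith
  have hpow : exp (-(a * l * (1 + δ))) ≤ x ^ (N - M) := by
    calc
      _ = exp (-((1 + δ) * y)) ^ n := by
        rw [← Real.exp_nat_mul, hy]
        congr 1
        field_simp
      _ ≤ x ^ n := by gcongr
      _ ≤ x ^ (N - M) := pow_le_pow_of_le_one hx0'.le hx1 (by omega)
  have he : exp (-(4 * δ)) ≤ (1 - δ) * (1 - δ) := by
    have h := exp_neg_two_mul_le_one_sub hδ0.le hδ1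
    calc
      _ = exp (-(2 * δ)) * exp (-(2 * δ)) := by
        rw [← Real.exp_add]
        congr 1
        ring
      _ ≤ _ := by gcongr; linarith
  have hδ2 : 0 ≤ 1 - δ := by linarith
  calc
    _ ≤ (a * l * ((1 - δ) * (1 - δ))) ^ M / M.factorial * x ^ (N - M) := by gcongr
    _ = ((1 - δ) * n) ^ M / M.factorial * (((1 - δ) * y) ^ M * x ^ (N - M)) := by
      rw [div_mul_eq_mul_div, div_mul_eq_mul_div, ← mul_assoc (((1 - δ) * (n : ℝ)) ^ M), ← mul_pow]
      congr 3
      rw [hy]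
      field_simp
    _ ≤ N.choose M * ((1 - x) ^ M * x ^ (N - M)) := by
      gcongr
      exact le_trans (by gcongr) (Nat.pow_le_choose (α := ℝ) M N)

lemma factorial_le_pow_mul_exp {M : ℕ} (hM : 1 ≤ M) :
    (M.factorial : ℝ) ≤ M ^ (M + 1) * exp (1 - M) := by
  induction M, hM using Nat.le_induction with
  | base => simp
  | succ M hM ih =>
    have hM' : (0 : ℝ) < M := by exact_mod_cast hM
    have hkey : (M : ℝ) ^ (M + 1) * exp 1 ≤ ((M : ℝ) + 1) ^ (M + 1) := by
      have h1 : exp (1 / ((M : ℝ) + 1)) ≤ ((M : ℝ) + 1) / M := by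
        rw [← Real.le_log_iff_exp_le (by positivity)]
        refine le_trans (le_of_eq ?_) (Real.one_sub_inv_le_log_of_pos (by positivity))
        field_simp
        ring
      have h2 : exp 1 ≤ (((M : ℝ) + 1) / M) ^ (M + 1) := by
        refine le_trans (le_of_eq ?_) (pow_le_pow_left₀ (exp_pos _).le h1 (M + 1))
        rw [← Real.exp_nat_mul]
        congr 1
        push_cast
        field_simp
      rw [div_pow, le_div_iff₀ (by positivity)] at h2
      linarith
    have he : exp (1 - (M : ℝ)) = exp 1 * exp (1 - ((M + 1 : ℕ) : ℝ)) := by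
      rw [← Real.exp_add]
      congr 1
      push_cast
      ring
    rw [Nat.factorial_succ]
    push_cast at he ⊢
    calc
      _ ≤ ((M : ℝ) + 1) * (M ^ (M + 1) * exp (1 - M)) := by gcongr
      _ = ((M : ℝ) + 1) * (M ^ (M + 1) * exp 1) * exp (1 - (M + 1)) := by rw [he]; ring
      _ ≤ ((M : ℝ) + 1) * ((M : ℝ) + 1) ^ (M + 1) * exp (1 - (M + 1)) := by gcongr
      _ = _ := by ring

/-- The exponential rate at which a Poisson variable of mean `l * M` fails to reach `M`,
for `l ≤ 1`. -/
noncomputable def rate (l : ℝ) : ℝ := l - 1 - Real.log l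

/-- An antiderivative of `rate`. -/
noncomputable def rateInt (l : ℝ) : ℝ := l ^ 2 / 2 - l * Real.log l

lemma rate_nonneg {l : ℝ} (h : 0 < l) : 0 ≤ rate l := by
  have := Real.log_le_sub_one_of_pos h
  unfold rate
  linarith

lemma exp_neg_rate_le {M : ℕ} {l δ : ℝ} (hM : 1 ≤ M) (hδ : 0 ≤ δ) (hMδ : exp 1 * M ≤ exp (δ * M))
    (hl0 : 0 < l) (hl1 : l ≤ 1) :
    exp (-(M * rate l + 6 * δ * M)) ≤
      (M * l * exp (-(4 * δ))) ^ M / M.factorial * exp (-(M * l * (1 + δ))) := by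
  have hM' : (0 : ℝ) < M := by exact_mod_cast hM
  have h1 : exp (M - δ * M) ≤ (M : ℝ) ^ M / M.factorial := by
    rw [le_div_iff₀ (by positivity)]
    calc
      _ ≤ exp (M - δ * M) * (M ^ (M + 1) * exp (1 - M)) := by
        gcongr
        exact factorial_le_pow_mul_exp hM
      _ = (M : ℝ) ^ M * (exp 1 * M) * (exp (M - δ * M) * exp (-M)) := by
        rw [sub_eq_add_neg (1 : ℝ), Real.exp_add]
        ring
      _ ≤ (M : ℝ) ^ M * exp (δ * M) * (exp (M - δ * M) * exp (-M)) := by gcongr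
      _ = (M : ℝ) ^ M := by
        rw [mul_assoc, ← Real.exp_add, ← Real.exp_add]
        ring_nf
        simp
  have h2 : (M * l * exp (-(4 * δ))) ^ M / M.factorial * exp (-(M * l * (1 + δ))) =
      (M : ℝ) ^ M / M.factorial * exp (M * Real.log l - 4 * δ * M - M * l * (1 + δ)) := by
    have : l ^ M = exp (M * Real.log l) := by rw [Real.exp_nat_mul, Real.exp_log hl0]
    rw [mul_pow, mul_pow, this, ← Real.exp_nat_mul, sub_eq_add_neg, sub_eq_add_neg, Real.exp_add,
      Real.exp_add]
    ring_nf
  rw [h2]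
  refine le_trans ?_ (mul_le_mul_of_nonneg_right h1 (exp_pos _).le)
  rw [← Real.exp_add, Real.exp_le_exp, rate]
  nlinarith [mul_nonneg (mul_nonneg hM'.le hδ) (sub_nonneg.2 hl1)]

lemma mul_rate_le_sub {l u : ℝ} (hl : 0 < l) (hlu : l ≤ u) (hu : u ≤ 1) :
    (u - l) * rate u ≤ rateInt u - rateInt l := by
  have hder : ∀ x ∈ Set.Icc l u, HasDerivAt rateInt (rate x) x := by
    intro x hx
    have hx0 : x ≠ 0 := (hl.trans_le hx.1).ne'
    have h := ((hasDerivAt_pow 2 x).div_const 2).sub ((hasDerivAt_id x).mul (Real.hasDerivAt_log hx0))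
    refine h.congr_deriv ?_
    simp only [rate, id]
    field_simp
    ring
  have := (convex_Icc l u).mul_sub_le_image_sub_of_le_deriv (f := rateInt) (C := rate u)
    (fun x hx => (hder x hx).continuousAt.continuousWithinAt)
    (fun x hx => (hder x (interior_subset hx)).differentiableAt.differentiableWithinAt)
    (fun x hx => by
      have hx' := interior_subset hx
      have hx0 : 0 < x := hl.trans_le hx'.1
      rw [(hder x hx').deriv, rate, rate]
      have h1 := Real.one_sub_inv_le_log_of_pos (div_pos (hx0.trans_le hx'.2) hx0)
      rw [Real.log_div (hx0.trans_le hx'.2).ne' hx0.ne', inv_div] at h1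
      have h2 : x / u ≤ 1 - (u - x) := by
        rw [div_le_iff₀ (hx0.trans_le hx'.2)]
        nlinarith [mul_nonneg (sub_nonneg.2 hx'.2) (sub_nonneg.2 hu)]
      linarith)
    l ⟨le_rfl, hlu⟩ u ⟨hlu, le_rfl⟩ hlu
  linarith

/-- Riemann sum estimate for `rate` along the levels `l + h * min i b`. -/
lemma sum_rate_le {l h : ℝ} {b : ℕ} (hl : 0 < l) (hh : 0 < h) (hb : l + h * b ≤ 1) (J : ℕ) :
    h * ∑ i ∈ Finset.range J, rate (l + h * (min i b : ℕ)) ≤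
      h * rate l + (rateInt 1 - rateInt l) + h * J * rate (l + h * b) := by
  have hpos : ∀ i : ℕ, 0 < l + h * i := fun i => by positivity
  have hle : ∀ i ≤ b, l + h * i ≤ 1 := fun i hi => by
    refine le_trans ?_ hb
    gcongr
  have hbr := rate_nonneg (hpos b)
  have key : ∀ j : ℕ, h * ∑ i ∈ Finset.range (j + 1), rate (l + h * (min i b : ℕ)) ≤
      h * rate l + (rateInt (l + h * (min j b : ℕ)) - rateInt l) + h * j * rate (l + h * b) := by
    intro j
    induction j with
    | zero => simp
    | succ j ih =>
      rw [Finset.sum_range_succ, mul_add]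
      by_cases hj : j < b
      · have h1 := mul_rate_le_sub (l := l + h * j) (u := l + h * (j + 1 : ℕ)) (hpos j)
          (by push_cast; linarith) (hle _ hj)
        rw [min_eq_left hj.le] at ih
        rw [min_eq_left (show j + 1 ≤ b from hj)]
        simp only [Nat.cast_add, Nat.cast_one] at h1 ⊢
        nlinarith [mul_nonneg hh.le hbr]
      · rw [min_eq_right (by omega)] at ih
        rw [min_eq_right (by omega)]
        simp only [Nat.cast_add, Nat.cast_one]
        linarith
  have hint : ∀ i ≤ b, rateInt (l + h * i) ≤ rateInt 1 := by
    intro i hi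
    have := mul_rate_le_sub (hpos i) (hle i hi) le_rfl
    have h0 : rate 1 = 0 := by simp [rate]
    rw [h0] at this
    linarith
  cases J with
  | zero =>
    have := hint 0 (Nat.zero_le _)
    have h0 := mul_nonneg hh.le (rate_nonneg hl)
    simp at this ⊢
    linarith
  | succ j =>
    refine (key j).trans ?_
    have := hint (min j b) (min_le_right _ _)
    simp only [Nat.cast_add, Nat.cast_one]
    nlinarith [mul_nonneg hh.le hbr]

lemma rate_le_of_one_sub_le {l t : ℝ} (hl : 0 < l) (hl1 : l ≤ 1) (h : 1 - l ≤ t * l) :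
    rate l ≤ t := by
  have h1 := Real.one_sub_inv_le_log_of_pos hl
  have h2 : l⁻¹ ≤ 1 + t := by
    rw [inv_le_iff_one_le_mul₀ hl]
    linarith
  unfold rate
  linarith

/-- Lower bound, up to a power of the size of the generations, for the probability that the first
exploration step finds `M` vertices. -/
noncomputable def startProb (ε δ : ℝ) (M : ℕ) : ℝ :=
  ((1 - ε) * exp (-(4 * δ))) ^ M / M.factorial * exp (-((1 - ε) * (1 + δ)))

lemma startProb_pos {ε δ : ℝ} (hε : ε < 1) (M : ℕ) : 0 < startProb ε δ M := by
  have : 0 < 1 - ε := by linarith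
  unfold startProb
  positivity

lemma startProb_le_one {ε δ : ℝ} (hε : ε < 1) (hδ : 0 ≤ δ) (M : ℕ) : startProb ε δ M ≤ 1 := by
  have h : 0 < 1 - ε := by linarith
  calc
    _ ≤ exp ((1 - ε) * exp (-(4 * δ))) * exp (-((1 - ε) * (1 + δ))) := by
      unfold startProb
      gcongr
      exact Real.pow_div_factorial_le_exp _ (by positivity) M
    _ ≤ 1 := by
      rw [← Real.exp_add, Real.exp_le_one_iff]
      have h1 : exp (-(4 * δ)) ≤ 1 := Real.exp_le_one_iff.2 (by linarith)
      nlinarith [mul_le_mul_of_nonneg_left h1 h.le, mul_nonneg h.le hδ]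

lemma measureReal_barren_univ_le {n M T : ℕ} {ε r δ K : ℝ} (hε0 : 0 < ε) (hε1 : ε < 1) (hr : 0 < r)
    (hδ0 : 0 < δ) (hδ1 : δ ≤ 1 / 2) (hK : 0 ≤ K) (hM : 1 ≤ M)
    (hMδ : exp 1 * M ≤ exp (δ * M)) (hn : 0 < n) (hL : 0 < Real.log n)
    (hp2 : (1 - ε) / n ≤ δ / (1 + δ)) (hp3 : r / (n * Real.log n) ≤ δ / (1 + δ))
    (hMn : M ≤ δ * n) (hrM : r * M ≤ δ * (1 - ε) * Real.log n)
    (hT : T * (1 + 2 * M + K * Real.log n) + M ≤ δ * n) :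
    (hypMeasure n ε r).real (barren ⌈K * Real.log n⌉₊ Finset.univ) ≤
      exp (-(T * (startProb ε δ M * exp (-(M * rate (1 - ε) + 7 * δ * M)) *
        exp (-((-Ier ε r + 7 * δ * K) * Real.log n))))) := by
  set L := Real.log n with hLdef
  set p₂ := (1 - ε) / n with hp₂
  set p₃ := r / (n * L) with hp₃
  have hn' : (0 : ℝ) < n := by exact_mod_cast hn
  have hM' : (0 : ℝ) < M := by exact_mod_cast hM
  have h1ε : 0 < 1 - ε := by linarith
  have hδ' : δ / (1 + δ) ≤ 1 := by
    rw [div_le_one (by linarith)]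
    linarith
  have hp20 : 0 ≤ p₂ := by positivity
  have hp30 : 0 ≤ p₃ := by positivity
  have h2 : p₂ ∈ Set.Icc (0 : ℝ) 1 := ⟨hp20, hp2.trans hδ'⟩
  have h3 : p₃ ∈ Set.Icc (0 : ℝ) 1 := ⟨hp30, hp3.trans hδ'⟩
  set h := r * M / L with hh
  have hh0 : 0 < h := by positivity
  set b := ⌊ε / h⌋₊ with hb
  set J := ⌈K * L / M⌉₊ with hJ
  have hbh : h * b ≤ ε := by
    have := Nat.floor_le (div_nonneg hε0.le hh0.le)
    rw [le_div_iff₀ hh0] at this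
    linarith
  have hbh' : ε < h * b + h := by
    have := Nat.lt_floor_add_one (ε / h)
    rw [div_lt_iff₀ hh0] at this
    linarith
  have hJM : (J : ℝ) * M ≤ K * L + M := by
    have := (Nat.ceil_lt_add_one (a := K * L / M) (by positivity)).le
    calc
      _ ≤ (K * L / M + 1) * M := by gcongr
      _ = _ := by field_simp
  have hm : ⌈K * L⌉₊ ≤ J * M := by
    rw [Nat.ceil_le]
    have := Nat.le_ceil (K * L / M)
    rw [div_le_iff₀ hM'] at this
    exact_mod_cast this
  set c := 1 + M + J * M with hc
  have hTc : (T * c : ℕ) + (M : ℝ) ≤ δ * n := by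
    refine le_trans ?_ hT
    have : (T : ℝ) * (1 + M + J * M) ≤ T * (1 + 2 * M + K * L) :=
      mul_le_mul_of_nonneg_left (by linarith) (Nat.cast_nonneg T)
    push_cast [hc]
    linarith
  have hTcn : T * c ≤ n := by
    have : ((T * c : ℕ) : ℝ) ≤ n := by nlinarith
    exact_mod_cast this
  have hlarge : ∀ U : Finset (Fin n), n - T * c ≤ U.card →
      (1 - δ) * n ≤ (U.card + 1 - M : ℕ) := by
    intro U hU
    have h1 : n ≤ U.card + 1 - M + (T * c + M) := by omega
    have h2 : (n : ℝ) ≤ (U.card + 1 - M : ℕ) + ((T * c : ℕ) + M) := by exact_mod_cast h1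
    linarith
  have hUn : ∀ U : Finset (Fin n), U.card ≤ n := fun U => by
    simpa using Finset.card_le_univ U
  have hlev : ∀ i : ℕ, 0 < 1 - ε + h * (min i b : ℕ) := fun i => by positivity
  have hlev1 : ∀ i : ℕ, 1 - ε + h * (min i b : ℕ) ≤ 1 := fun i => by
    have : h * (min i b : ℕ) ≤ h * b := by
      gcongr
      exact min_le_right i b
    linarith
  set q : ℕ → ℝ := fun i => exp (-(M * rate (1 - ε + h * (min i b : ℕ)) + 6 * δ * M)) with hq
  have hprod : ∏ k ∈ Finset.Ico 0 J, q k =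
      exp (-(M * ∑ i ∈ Finset.range J, rate (1 - ε + h * (min i b : ℕ)) + 6 * δ * (J * M))) := by
    rw [← Finset.range_eq_Ico, hq, ← Real.exp_sum, Finset.sum_neg_distrib, Finset.sum_add_distrib,
      ← Finset.mul_sum]
    congr 2
    simp
    ring
  have hprod1 : ∏ k ∈ Finset.Ico 0 J, q k ≤ 1 := by
    refine Finset.prod_le_one (fun i _ => (exp_pos _).le) fun i _ => ?_
    rw [hq, Real.exp_le_one_iff, neg_nonpos]
    have := rate_nonneg (hlev i)
    positivity
  have hprod0 : 0 ≤ ∏ k ∈ Finset.Ico 0 J, q k := Finset.prod_nonneg fun i _ => (exp_pos _).le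
  have hs0 := startProb_pos (δ := δ) hε1 M
  have hs1 := startProb_le_one hε1 hδ0.le M
  have hle : startProb ε δ M * ∏ k ∈ Finset.Ico 0 J, q k ≤ 1 := mul_le_one₀ hs1 hprod0 hprod1
  have hmain := measureReal_barren_le (m := ⌈K * L⌉₊) (U := Finset.univ) (n₀ := n - T * c) h2 h3
    (q := q) (q₀ := startProb ε δ M) (M := M) (b := b) (J := J) (fun i => (exp_pos _).le)
    (by
      intro i _ A B U hAB hAU hBU hA hB hU
      refine (exp_neg_rate_le hM hδ0.le hMδ (hlev i) (hlev1 i)).trans ?_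
      refine le_trans ?_ (le_measureReal_card_nbr h2 h3 hAB hAU hBU M rfl)
      rw [hA, hB]
      refine le_choose_mul_pow (n := n) hn hδ0 hδ1 hp20 hp2 hp30 hp3 ?_ ?_ (hUn U) (hlarge U hU) rfl
      · rw [hp₂, hp₃, hh, Nat.cast_mul]
        field_simp
      · nlinarith [hlev1 i])
    (by
      intro v U hv hU
      refine le_trans ?_ (le_measureReal_card_nbr h2 h3 (by simp) (by simpa using hv) (by simp) M
        rfl)
      have := le_choose_mul_pow (n := n) (N := U.card) (M := M) (a := 1) (b := 0) (l := 1 - ε)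
        hn hδ0 hδ1 hp20 hp2 hp30 hp3 (by rw [hp₂]; field_simp; simp) ?_ (hUn U) (hlarge U hU) rfl
      · simpa [startProb] using this
      · have : (1 : ℝ) ≤ M := by exact_mod_cast hM
        push_cast
        linarith)
    hle hm T (by simp [← hc]; omega)
  refine hmain.trans ?_
  calc
    _ ≤ exp (-(startProb ε δ M * ∏ k ∈ Finset.Ico 0 J, q k)) ^ T := by
      gcongr
      exact Real.one_sub_le_exp_neg _
    _ = exp (-(T * (startProb ε δ M * ∏ k ∈ Finset.Ico 0 J, q k))) := by
      rw [← Real.exp_nat_mul, mul_neg]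
    _ ≤ _ := by
      rw [Real.exp_le_exp, neg_le_neg_iff]
      refine mul_le_mul_of_nonneg_left ?_ (Nat.cast_nonneg T)
      rw [mul_assoc, hprod, ← Real.exp_add]
      refine mul_le_mul_of_nonneg_left (Real.exp_le_exp.2 ?_) hs0.le
      have hsum := sum_rate_le (l := 1 - ε) (h := h) (b := b) h1ε hh0 (by linarith) J
      have hrate : rate (1 - ε + h * b) ≤ δ := by
        refine rate_le_of_one_sub_le (by positivity) (by linarith) ?_
        have : h ≤ δ * (1 - ε) := by rwa [hh, div_le_iff₀ hL]
        have : 0 ≤ δ * (h * b) := by positivity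
        linarith
      have hI : rateInt 1 - rateInt (1 - ε) = r * -Ier ε r := by
        simp only [rateInt, Ier, Real.log_one]
        field_simp
        ring
      have hMh : M = L / r * h := by
        rw [hh]
        field_simp
      have hsum' := mul_le_mul_of_nonneg_left hsum (show 0 ≤ L / r by positivity)
      rw [hI] at hsum'
      have e1 : L / r * (h * ∑ i ∈ Finset.range J, rate (1 - ε + h * (min i b : ℕ))) =
          M * ∑ i ∈ Finset.range J, rate (1 - ε + h * (min i b : ℕ)) := by
        rw [hMh]
        ring
      have e2 : L / r * (h * rate (1 - ε) + r * -Ier ε r + h * J * rate (1 - ε + h * b)) =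
          M * rate (1 - ε) + L * -Ier ε r + J * M * rate (1 - ε + h * b) := by
        rw [hMh]
        field_simp
      rw [e1, e2] at hsum'
      have h4 : J * M * rate (1 - ε + h * b) ≤ J * M * δ := by gcongr
      have h5 := mul_le_mul_of_nonneg_left hJM (show 0 ≤ 7 * δ by positivity)
      linarith

lemma exists_exp_one_mul_le_exp {δ : ℝ} (hδ : 0 < δ) :
    ∃ M : ℕ, 1 ≤ M ∧ exp 1 * M ≤ exp (δ * M) := by
  have hx : Tendsto (fun M : ℕ => δ * (M : ℝ)) atTop atTop :=
    tendsto_natCast_atTop_atTop.const_mul_atTop hδ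
  have h := (Real.tendsto_pow_mul_exp_neg_atTop_nhds_zero 1).comp hx
  obtain ⟨M, hM, hM1⟩ := ((h.eventually_lt_const (show 0 < δ / exp 1 by positivity)).and
    (eventually_ge_atTop 1)).exists
  refine ⟨M, hM1, ?_⟩
  simp only [Function.comp_apply, pow_one, Real.exp_neg] at hM
  rw [← div_eq_mul_inv, div_lt_div_iff₀ (exp_pos _) (exp_pos _), mul_assoc] at hM
  linarith [lt_of_mul_lt_mul_left hM hδ.le]

lemma eventually_add_mul_log_le (A K : ℝ) {c s : ℝ} (hc : 0 < c) (hs : 0 < s) :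
    ∀ᶠ n : ℕ in atTop, A + K * Real.log n ≤ c * (n : ℝ) ^ s := by
  have h1 : (fun x : ℝ => A + K * Real.log x) =o[atTop] fun x => x ^ s := by
    refine .add ?_ ((isLittleO_log_rpow_atTop hs).const_mul_left K)
    exact (Asymptotics.isLittleO_const_left_of_ne (by norm_num : (1 : ℝ) ≠ 0)).2
      (tendsto_norm_atTop_atTop.comp (tendsto_rpow_atTop hs)) |>.const_mul_left A |>.congr_left
        (by simp)
  filter_upwards [tendsto_natCast_atTop_atTop.eventually (h1.bound hc)] with n hn
  refine (le_abs_self _).trans (hn.trans_eq ?_)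
  rw [Real.norm_of_nonneg (by positivity)]

lemma tendsto_measureReal_barren {ε r K : ℝ} (hε0 : 0 < ε) (hε1 : ε < 1) (hr : 0 < r)
    (hI : -1 < Ier ε r) (hK : 0 < K) :
    Tendsto (fun n : ℕ => (hypMeasure n ε r).real (barren ⌈K * Real.log n⌉₊ Finset.univ))
      atTop (nhds 0) := by
  set κ := (1 + Ier ε r) / 4 with hκ
  have hκ0 : 0 < κ := by linarith
  set δ := min (1 / 2) (κ / (7 * K)) with hδ
  have hδ0 : 0 < δ := by positivity
  have hδ1 : δ ≤ 1 / 2 := min_le_left _ _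
  have hδK : 7 * δ * K ≤ κ := by
    have := min_le_right (1 / 2) (κ / (7 * K))
    rw [← hδ, le_div_iff₀ (by positivity)] at this
    linarith
  obtain ⟨M, hM, hMδ⟩ := exists_exp_one_mul_le_exp hδ0
  set C := startProb ε δ M * exp (-(M * rate (1 - ε) + 7 * δ * M)) with hC
  have hC0 : 0 < C := mul_pos (startProb_pos hε1 M) (exp_pos _)
  have hnat : Tendsto (fun n : ℕ => (n : ℝ)) atTop atTop := tendsto_natCast_atTop_atTop
  have hlog : Tendsto (fun n : ℕ => Real.log n) atTop atTop := Real.tendsto_log_atTop.comp hnat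
  have hlim : Tendsto (fun n : ℕ => exp (-(C * exp (2 * κ * Real.log n)))) atTop (nhds 0) :=
    Real.tendsto_exp_neg_atTop_nhds_zero.comp ((Real.tendsto_exp_atTop.comp
      (hlog.const_mul_atTop (by positivity))).const_mul_atTop hC0)
  have hquot : 0 < δ / (1 + δ) := by positivity
  refine squeeze_zero' (.of_forall fun n => measureReal_nonneg) ?_ hlim
  filter_upwards [eventually_gt_atTop 0, hlog.eventually_gt_atTop 0,
    (hnat.const_div_atTop (1 - ε)).eventually_le_const hquot,
    ((hnat.atTop_mul_atTop₀ hlog).const_div_atTop r).eventually_le_const hquot,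
    (hnat.const_mul_atTop (show 0 < δ / 4 by positivity)).eventually_ge_atTop (M : ℝ),
    (hlog.const_mul_atTop (show 0 < δ * (1 - ε) by nlinarith)).eventually_ge_atTop (r * M),
    eventually_add_mul_log_le (1 + 2 * M) K (show 0 < δ / 4 by positivity) hκ0,
    eventually_add_mul_log_le (1 + 2 * M) K (show 0 < δ / 4 by positivity) one_pos]
    with n hn hL hp2 hp3 hMn hrM hl hl'
  have hn' : (0 : ℝ) < n := by exact_mod_cast hn
  rw [Real.rpow_one] at hl'
  have hT := Nat.ceil_lt_add_one (a := (n : ℝ) ^ (1 - κ)) (by positivity)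
  have hT' := Nat.le_ceil ((n : ℝ) ^ (1 - κ))
  set T := ⌈(n : ℝ) ^ (1 - κ)⌉₊
  have hTn : T * (1 + 2 * M + K * Real.log n) + M ≤ δ * n := by
    calc
      _ ≤ ((n : ℝ) ^ (1 - κ) + 1) * (1 + 2 * M + K * Real.log n) + M := by gcongr
      _ = (n : ℝ) ^ (1 - κ) * (1 + 2 * M + K * Real.log n) + (1 + 2 * M + K * Real.log n) + M := by
        ring
      _ ≤ (n : ℝ) ^ (1 - κ) * (δ / 4 * (n : ℝ) ^ κ) + δ / 4 * n + δ / 4 * n := by gcongr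
      _ = δ / 4 * ((n : ℝ) ^ (1 - κ) * (n : ℝ) ^ κ) + δ / 4 * n + δ / 4 * n := by ring
      _ = δ / 4 * n + δ / 4 * n + δ / 4 * n := by
        rw [← Real.rpow_add hn', sub_add_cancel, Real.rpow_one]
      _ ≤ _ := by nlinarith
  refine (measureReal_barren_univ_le hε0 hε1 hr hδ0 hδ1 hK.le hM hMδ hn hL hp2 hp3 (by nlinarith)
    hrM hTn).trans ?_
  rw [← hC, Real.exp_le_exp, neg_le_neg_iff]
  calc
    _ ≤ C * exp ((1 - κ) * Real.log n - (-Ier ε r + 7 * δ * K) * Real.log n) := by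
      gcongr
      rw [← sub_mul]
      gcongr
      linarith
    _ = (n : ℝ) ^ (1 - κ) * (C * exp (-((-Ier ε r + 7 * δ * K) * Real.log n))) := by
      rw [Real.rpow_def_of_pos hn', sub_eq_add_neg, Real.exp_add, mul_comm (1 - κ)]
      ring
    _ ≤ _ := by gcongr

end GoodVertex

/-- If `I_{ε,r} > -1` then w.h.p. `𝔾(n,p₂,p₃)` contains a good vertex. -/
theorem good_vertex_exists_whp (ε r : ℝ) (hε0 : 0 < ε) (hε1 : ε < 1) (hr : 0 < r)
    (hI : -1 < Ier ε r) :
    Tendsto (fun n : ℕ => hypMeasure n ε r {ω | 0 < goodCount n ε r ω})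
      atTop (nhds 1) := by
  have hK : 0 < K0 ε r := lt_of_lt_of_le one_pos (le_max_left _ _)
  have hbarren := GoodVertex.tendsto_measureReal_barren hε0 hε1 hr hI hK
  have hnat : Tendsto (fun n : ℕ => (n : ℝ)) atTop atTop := tendsto_natCast_atTop_atTop
  have hlog : Tendsto (fun n : ℕ => Real.log n) atTop atTop := Real.tendsto_log_atTop.comp hnat
  have hprob : ∀ᶠ n : ℕ in atTop, IsProbabilityMeasure (hypMeasure n ε r) := by
    filter_upwards [hlog.eventually_gt_atTop 0,
      (hnat.const_div_atTop (1 - ε)).eventually_le_const one_pos,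
      ((hnat.atTop_mul_atTop₀ hlog).const_div_atTop r).eventually_le_const one_pos]
      with n hL h2 h3
    have : 0 < 1 - ε := by linarith
    exact GoodVertex.isProbabilityMeasure_edgeLaw ⟨by positivity, h2⟩ ⟨by positivity, h3⟩
  have hlow : Tendsto (fun n : ℕ => ENNReal.ofReal (1 - (hypMeasure n ε r).real
      (GoodVertex.barren ⌈K0 ε r * Real.log n⌉₊ Finset.univ))) atTop (nhds 1) := by
    simpa using ENNReal.tendsto_ofReal (hbarren.const_sub 1)
  refine tendsto_of_tendsto_of_tendsto_of_le_of_le' hlow tendsto_const_nhds ?_ ?_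
  · filter_upwards [hprob] with n hn
    rw [← probReal_compl_eq_one_sub (Set.toFinite _).measurableSet, ofReal_measureReal]
    refine measure_mono fun ω hω => ?_
    simp only [GoodVertex.barren, Set.mem_compl_iff, Set.mem_ofPred_eq, not_forall,
      not_not] at hω
    obtain ⟨v, -, hv⟩ := hω
    exact (hv.mono fun e he => (GoodVertex.keep_eq_true.1 he).2).goodCount_pos
      (Nat.le_ceil _)
  · filter_upwards [hprob] with n hn
    exact prob_le_one
end
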